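/- arXiv:1003.1649 — 6 statements merged into one kernel-verified Lean document; each statement's English description precedes it below -/
import Mathlib

section
/- Let n ≥ 1 and k ≥ 1 be integers and let φ : ℝⁿ → ℝ be a continuously differentiable function such that |φ|^{2k} and ‖∇φ‖^{2k} are integrable with respect to μ. Then ∫_{ℝⁿ} |φ(x) − ∫ φ dμ|^{2k} dμ(x) ≤ (π/2)^{2k} · ((2k)! / (2^k · k!)) · ∫_{ℝⁿ} ‖∇φ(x)‖^{2k} dμ(x). -/
open MeasureTheory

/-- The standard Gaussian measure on `ℝⁿ`. -/
noncomputable def stdGaussian (n : ℕ) : Measure (EuclideanSpace ℝ (Fin n)) :=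
  volume.withDensity fun x =>
    ENNReal.ofReal ((2 * Real.pi) ^ (-(n : ℝ) / 2) * Real.exp (-‖x‖ ^ 2 / 2))

/-- The measure defined by the Gaussian density is the standard Gaussian measure of Mathlib. -/
theorem stdGaussian_eq_probabilityTheory_stdGaussian (n : ℕ) :
    stdGaussian n = ProbabilityTheory.stdGaussian (EuclideanSpace ℝ (Fin n)) := by
  have hint : Integrable (fun x : EuclideanSpace ℝ (Fin n) =>
      (2 * Real.pi) ^ (-(n : ℝ) / 2) * Real.exp (-‖x‖ ^ 2 / 2)) := by
    refine Integrable.const_mul ?_ _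
    have h := (GaussianFourier.integrable_cexp_neg_mul_sq_norm_add
      (b := 1 / 2) (by norm_num) 0 (0 : EuclideanSpace ℝ (Fin n))).norm
    refine h.congr (Filter.Eventually.of_forall fun x => ?_)
    simp only [Complex.norm_exp]
    congr 1
    simp [← Complex.ofReal_pow]
    ring
  have hfin : IsFiniteMeasure (stdGaussian n) :=
    isFiniteMeasure_withDensity_ofReal hint.2
  apply Measure.ext_of_charFun
  ext t
  rw [ProbabilityTheory.charFun_stdGaussian, charFun_apply, stdGaussian,
    integral_withDensity_eq_integral_toReal_smul (by fun_prop)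
      (Filter.Eventually.of_forall fun _ => ENNReal.ofReal_lt_top)]
  have h := GaussianFourier.integral_cexp_neg_mul_sq_norm_add
    (b := 1 / 2) (by norm_num) Complex.I t
  have hπ : (0 : ℝ) ≤ 2 * Real.pi := by positivity
  calc _ = ∫ v : EuclideanSpace ℝ (Fin n), (((2 * Real.pi) ^ (-(n : ℝ) / 2) : ℝ) : ℂ) *
        Complex.exp (-(1 / 2) * ‖v‖ ^ 2 + Complex.I * inner ℝ t v) := by
        congr 1 with v
        rw [ENNReal.toReal_ofReal (by positivity), Complex.real_smul, Complex.exp_add,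
          real_inner_comm]
        push_cast
        rw [mul_assoc]
        congr 3
        · ring_nf
        · ring_nf
    _ = _ := by
        rw [integral_const_mul, h, ← mul_assoc, Complex.ofReal_cpow hπ]
        have : (Real.pi / (1 / 2) : ℂ) = ((2 * Real.pi : ℝ) : ℂ) := by push_cast; ring
        rw [this, ← Complex.cpow_add]
        · simp only [finrank_euclideanSpace, Fintype.card_fin]
          push_cast
          rw [show (-(n : ℂ) / 2 + n / 2) = 0 by ring, Complex.cpow_zero, one_mul, Complex.I_sq]
          ring_nf
        · exact_mod_cast (by positivity : (2 * Real.pi : ℝ) ≠ 0)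

/-- The Jensen inequality for natural powers on a finite measure space. -/
theorem lintegral_enorm_pow_le {α : Type*} {m : MeasurableSpace α} {ν : Measure α} {f : α → ℝ}
    (hf : AEStronglyMeasurable f ν) {p : ℕ} (hp : 1 ≤ p) :
    (∫⁻ a, ‖f a‖ₑ ∂ν) ^ p ≤ ν Set.univ ^ (p - 1) * ∫⁻ a, ‖f a‖ₑ ^ p ∂ν := by
  have hp' : (p : ℝ) ≠ 0 := by positivity
  have h := eLpNorm'_le_eLpNorm'_mul_rpow_measure_univ (p := 1) (q := p) one_pos
    (by exact_mod_cast hp) hf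
  simp only [eLpNorm'_eq_lintegral_enorm, ENNReal.rpow_one, ENNReal.rpow_natCast, div_one] at h
  refine (pow_le_pow_left₀ zero_le h p).trans_eq ?_
  rw [mul_pow, ← ENNReal.rpow_mul_natCast, ← ENNReal.rpow_mul_natCast, one_div_mul_cancel hp',
    ENNReal.rpow_one, mul_comm, sub_mul, one_div_mul_cancel hp', one_mul,
    ← ENNReal.rpow_natCast, Nat.cast_sub hp, Nat.cast_one]

/-- The even moments of the standard real Gaussian distribution. -/
theorem integral_pow_two_mul_gaussianReal (k : ℕ) :
    ∫ x, x ^ (2 * k) ∂ProbabilityTheory.gaussianReal 0 1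
      = ((2 * k).factorial : ℝ) / (2 ^ k * (k.factorial : ℝ)) := by
  have hfac : ∀ j : ℕ, Real.Gamma (j + 1 / 2)
      = √Real.pi * (((2 * j).factorial : ℝ) / (4 ^ j * (j.factorial : ℝ))) := by
    intro j
    induction j with
    | zero => simp [Real.Gamma_one_half_eq, -one_div]
    | succ j ih =>
      rw [show ((j + 1 : ℕ) : ℝ) + 1 / 2 = ((j : ℝ) + 1 / 2) + 1 by push_cast; ring,
        Real.Gamma_add_one (by positivity), ih, show 2 * (j + 1) = 2 * j + 1 + 1 by ring,
        Nat.factorial_succ, Nat.factorial_succ, Nat.factorial_succ]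
      push_cast
      field_simp
      ring
  rw [ProbabilityTheory.integral_gaussianReal_eq_integral_smul one_ne_zero]
  have hG := integral_rpow_mul_exp_neg_mul_rpow (p := 2) (q := 2 * k) (b := 1 / 2)
    two_pos (by linarith [(Nat.cast_nonneg k : (0 : ℝ) ≤ k)]) (by norm_num)
  calc _ = ∫ x : ℝ, (√(2 * Real.pi))⁻¹ *
        (|x| ^ (2 * (k : ℝ)) * Real.exp (-(1 / 2) * |x| ^ (2 : ℝ))) := by
        congr 1 with x
        have h1 : |x| ^ (2 * (k : ℝ)) = x ^ (2 * k) := by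
          rw [show (2 * (k : ℝ)) = ((2 * k : ℕ) : ℝ) by push_cast; ring, Real.rpow_natCast,
            pow_mul, sq_abs, pow_mul]
        rw [h1, Real.rpow_two, sq_abs, ProbabilityTheory.gaussianPDFReal, smul_eq_mul]
        simp only [NNReal.coe_one, mul_one, sub_zero]
        rw [mul_assoc, mul_comm (Real.exp _)]
        congr 3
        ring
    _ = (√(2 * Real.pi))⁻¹ * (2 * ∫ x in Set.Ioi (0 : ℝ),
          x ^ (2 * (k : ℝ)) * Real.exp (-(1 / 2) * x ^ (2 : ℝ))) := by
        rw [integral_const_mul,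
          integral_comp_abs (f := fun x => x ^ (2 * (k : ℝ)) * Real.exp (-(1 / 2) * x ^ (2 : ℝ)))]
    _ = _ := by
        rw [hG, show (2 * (k : ℝ) + 1) / 2 = k + 1 / 2 by ring, hfac,
          show -(2 * (k : ℝ) + 1) / 2 = -(k + 1 / 2) by ring, one_div,
          Real.inv_rpow two_pos.le, Real.rpow_neg two_pos.le, inv_inv,
          Real.rpow_add two_pos, Real.rpow_natCast, ← one_div (2 : ℝ), ← Real.sqrt_eq_rpow,
          Real.sqrt_mul two_pos.le, show (4 : ℝ) ^ k = 2 ^ k * 2 ^ k by rw [← mul_pow]; norm_num]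
        field_simp

/-- The even absolute moments of the standard real Gaussian distribution. -/
theorem lintegral_enorm_pow_two_mul_gaussianReal (k : ℕ) :
    ∫⁻ x, ‖x‖ₑ ^ (2 * k) ∂ProbabilityTheory.gaussianReal 0 1
      = ENNReal.ofReal (((2 * k).factorial : ℝ) / (2 ^ k * (k.factorial : ℝ))) := by
  rw [← integral_pow_two_mul_gaussianReal, ofReal_integral_eq_lintegral_ofReal]
  · refine lintegral_congr fun x => ?_
    rw [Real.enorm_eq_ofReal_abs, ← ENNReal.ofReal_pow (abs_nonneg x), pow_mul, sq_abs, pow_mul]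
  · have h := (ProbabilityTheory.memLp_id_gaussianReal' (μ := 0) (v := 1) ((2 * k : ℕ) : ENNReal)
      (ENNReal.natCast_ne_top _)).integrable_norm_pow'
    refine h.congr (Filter.Eventually.of_forall fun x => ?_)
    simp [pow_mul]
  · exact Filter.Eventually.of_forall fun x => by simp only [pow_mul]; positivity

/-- The even moments of a linear form under the standard Gaussian measure. -/
theorem lintegral_enorm_inner_pow_stdGaussian {E : Type*} [NormedAddCommGroup E]
    [InnerProductSpace ℝ E] [FiniteDimensional ℝ E] [MeasurableSpace E] [BorelSpace E]
    (v : E) (k : ℕ) :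
    ∫⁻ y, ‖inner ℝ v y‖ₑ ^ (2 * k) ∂ProbabilityTheory.stdGaussian E
      = ENNReal.ofReal (((2 * k).factorial : ℝ) / (2 ^ k * (k.factorial : ℝ)))
          * ‖v‖ₑ ^ (2 * k) := by
  have hmap : (ProbabilityTheory.stdGaussian E).map (innerSL ℝ v)
      = (ProbabilityTheory.gaussianReal 0 1).map (‖v‖ * ·) := by
    rw [ProbabilityTheory.IsGaussian.map_eq_gaussianReal,
      ProbabilityTheory.gaussianReal_map_const_mul,
      ProbabilityTheory.integral_strongDual_stdGaussian,
      ProbabilityTheory.variance_dual_stdGaussian, innerSL_apply_norm, mul_zero, mul_one]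
    congr 1
    ext
    simp
  calc _ = ∫⁻ t, ‖t‖ₑ ^ (2 * k) ∂(ProbabilityTheory.stdGaussian E).map (innerSL ℝ v) := by
        rw [lintegral_map (by fun_prop) (by fun_prop)]
        simp only [innerSL_apply_apply]
    _ = _ := by
        rw [hmap, lintegral_map (by fun_prop) (by fun_prop)]
        simp only [enorm_mul, mul_pow, enorm_norm]
        rw [lintegral_const_mul _ (by fun_prop), lintegral_enorm_pow_two_mul_gaussianReal, mul_comm]

/-- The increment of `φ` is bounded by integrating its derivative along a circular arc. -/
theorem enorm_sub_le_lintegral_rotation {E : Type*} [NormedAddCommGroup E]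
    [InnerProductSpace ℝ E] [CompleteSpace E] {φ : E → ℝ} (hφ : ContDiff ℝ 1 φ) (p : E × E) :
    ‖φ p.2 - φ p.1‖ₑ ≤ ∫⁻ θ in Set.Ioc 0 (Real.pi / 2),
      ‖inner ℝ (gradient φ (ContinuousLinearMap.rotation θ p).1)
        (ContinuousLinearMap.rotation θ p).2‖ₑ := by
  have hgrad : Continuous (gradient φ) :=
    (InnerProductSpace.toDual ℝ E).symm.continuous.comp (hφ.continuous_fderiv one_ne_zero)
  have hderiv : ∀ θ : ℝ, HasDerivAt (fun θ => φ (ContinuousLinearMap.rotation θ p).1)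
      (inner ℝ (gradient φ (ContinuousLinearMap.rotation θ p).1)
        (ContinuousLinearMap.rotation θ p).2) θ := by
    intro θ
    have h1 : HasDerivAt (fun θ : ℝ => (ContinuousLinearMap.rotation θ p).1)
        (ContinuousLinearMap.rotation θ p).2 θ := by
      simp only [ContinuousLinearMap.rotation_apply]
      exact ((Real.hasDerivAt_cos θ).smul_const p.1).add ((Real.hasDerivAt_sin θ).smul_const p.2)
    have h2 := ((hφ.differentiable one_ne_zero)
      (ContinuousLinearMap.rotation θ p).1).hasGradientAt.hasFDerivAt
    exact h2.comp_hasDerivAt θ h1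
  have hcont : Continuous fun θ : ℝ =>
      inner ℝ (gradient φ (ContinuousLinearMap.rotation θ p).1)
        (ContinuousLinearMap.rotation θ p).2 := by
    simp only [ContinuousLinearMap.rotation_apply]
    fun_prop
  have h := intervalIntegral.integral_eq_sub_of_hasDerivAt (a := 0) (b := Real.pi / 2)
    (fun θ _ => hderiv θ) (hcont.intervalIntegrable _ _)
  simp only [ContinuousLinearMap.rotation_apply, Real.cos_pi_div_two, Real.sin_pi_div_two,
    Real.cos_zero, Real.sin_zero, zero_smul, one_smul, zero_add, add_zero] at h
  rw [← h, intervalIntegral.integral_of_le (by positivity)]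
  simpa only [ContinuousLinearMap.rotation_apply] using enorm_integral_le_lintegral_enorm _

/-- The two-point form of the Gaussian moment inequality. -/
theorem lintegral_enorm_sub_pow_le {E : Type*} [NormedAddCommGroup E]
    [InnerProductSpace ℝ E] [FiniteDimensional ℝ E] [MeasurableSpace E] [BorelSpace E]
    {φ : E → ℝ} (hφ : ContDiff ℝ 1 φ) {k : ℕ} (hk : 1 ≤ k) :
    ∫⁻ p, ‖φ p.2 - φ p.1‖ₑ ^ (2 * k)
        ∂(ProbabilityTheory.stdGaussian E).prod (ProbabilityTheory.stdGaussian E)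
      ≤ ENNReal.ofReal (Real.pi / 2) ^ (2 * k)
          * (ENNReal.ofReal (((2 * k).factorial : ℝ) / (2 ^ k * (k.factorial : ℝ)))
            * ∫⁻ x, ‖gradient φ x‖ₑ ^ (2 * k) ∂ProbabilityTheory.stdGaussian E) := by
  set γ := ProbabilityTheory.stdGaussian E
  have hgrad : Continuous (gradient φ) :=
    (InnerProductSpace.toDual ℝ E).symm.continuous.comp (hφ.continuous_fderiv one_ne_zero)
  set g : E × E → ℝ := fun q => inner ℝ (gradient φ q.1) q.2
  have hgc : Continuous g := by fun_prop
  have hgR : Continuous fun z : (E × E) × ℝ => g (ContinuousLinearMap.rotation z.2 z.1) := by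
    simp only [ContinuousLinearMap.rotation_apply]
    fun_prop
  have hinner : ∫⁻ q, ‖g q‖ₑ ^ (2 * k) ∂γ.prod γ
      = ENNReal.ofReal (((2 * k).factorial : ℝ) / (2 ^ k * (k.factorial : ℝ)))
          * ∫⁻ x, ‖gradient φ x‖ₑ ^ (2 * k) ∂γ := by
    rw [lintegral_prod _ (by fun_prop), ← lintegral_const_mul _ (by fun_prop)]
    exact lintegral_congr fun x => lintegral_enorm_inner_pow_stdGaussian (gradient φ x) k
  have hrot : ∀ θ : ℝ, ∫⁻ p, ‖g (ContinuousLinearMap.rotation θ p)‖ₑ ^ (2 * k) ∂γ.prod γ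
      = ∫⁻ q, ‖g q‖ₑ ^ (2 * k) ∂γ.prod γ := by
    intro θ
    have h := ProbabilityTheory.IsGaussian.map_rotation_eq_self (μ := γ)
      (by simp [γ]) θ
    conv_rhs => rw [← h]
    rw [lintegral_map (by fun_prop) (by fun_prop)]
  calc _ ≤ ∫⁻ p, ENNReal.ofReal (Real.pi / 2) ^ (2 * k - 1) *
          (∫⁻ θ in Set.Ioc 0 (Real.pi / 2),
            ‖g (ContinuousLinearMap.rotation θ p)‖ₑ ^ (2 * k)) ∂γ.prod γ := by
        refine lintegral_mono fun p => ?_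
        have hm : AEStronglyMeasurable (fun θ => g (ContinuousLinearMap.rotation θ p))
            (volume.restrict (Set.Ioc 0 (Real.pi / 2))) :=
          (hgR.comp (Continuous.prodMk_right p)).aestronglyMeasurable
        refine (pow_le_pow_left₀ zero_le (enorm_sub_le_lintegral_rotation hφ p) _).trans ?_
        refine (lintegral_enorm_pow_le hm (by lia)).trans_eq ?_
        simp
    _ = ENNReal.ofReal (Real.pi / 2) ^ (2 * k - 1) *
          ∫⁻ θ in Set.Ioc 0 (Real.pi / 2), (∫⁻ p,
            ‖g (ContinuousLinearMap.rotation θ p)‖ₑ ^ (2 * k) ∂γ.prod γ) := by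
        rw [lintegral_const_mul' _ _ (by simp), lintegral_lintegral_swap]
        exact (hgR.measurable.enorm.pow_const _).aemeasurable
    _ = _ := by
        simp only [hrot, lintegral_const, hinner]
        rw [Measure.restrict_apply_univ, Real.volume_Ioc, sub_zero, mul_comm (_ * _), ← mul_assoc,
          ← pow_succ, Nat.sub_add_cancel (by lia)]

/-- Higher-moment Poincaré inequality for the Gaussian measure. -/
theorem gaussian_moment_poincare (n k : ℕ) (hn : 1 ≤ n) (hk : 1 ≤ k)
    (φ : EuclideanSpace ℝ (Fin n) → ℝ) (hφ : ContDiff ℝ 1 φ)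
    (hint : Integrable (fun x => |φ x| ^ (2 * k)) (stdGaussian n))
    (hgrad : Integrable (fun x => ‖gradient φ x‖ ^ (2 * k)) (stdGaussian n)) :
    ∫ x, |φ x - ∫ y, φ y ∂stdGaussian n| ^ (2 * k) ∂stdGaussian n
      ≤ (Real.pi / 2) ^ (2 * k)
          * (((2 * k).factorial : ℝ) / (2 ^ k * (k.factorial : ℝ)))
          * ∫ x, ‖gradient φ x‖ ^ (2 * k) ∂stdGaussian n := by
  rw [stdGaussian_eq_probabilityTheory_stdGaussian] at *
  set γ := ProbabilityTheory.stdGaussian (EuclideanSpace ℝ (Fin n))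
  have hφc : Continuous φ := hφ.continuous
  have hφint : Integrable φ γ := by
    refine ((integrable_const (1 : ℝ)).add hint).mono' hφc.aestronglyMeasurable
      (Filter.Eventually.of_forall fun x => ?_)
    rw [Real.norm_eq_abs, Pi.add_apply]
    rcases le_total |φ x| 1 with h | h
    · linarith [pow_nonneg (abs_nonneg (φ x)) (2 * k)]
    · linarith [le_self_pow₀ h (by lia : 2 * k ≠ 0)]
  have hjensen : ∀ x, ‖φ x - ∫ y, φ y ∂γ‖ₑ ^ (2 * k) ≤ ∫⁻ y, ‖φ y - φ x‖ₑ ^ (2 * k) ∂γ := by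
    intro x
    have h : ∫ y, φ y ∂γ - φ x = ∫ y, (φ y - φ x) ∂γ := by
      rw [integral_sub hφint (integrable_const _)]
      simp
    rw [← enorm_neg, neg_sub, h]
    refine (pow_le_pow_left₀ zero_le (enorm_integral_le_lintegral_enorm _) _).trans ?_
    refine (lintegral_enorm_pow_le (by fun_prop) (by lia)).trans_eq ?_
    simp
  have hgradL : ENNReal.ofReal (∫ x, ‖gradient φ x‖ ^ (2 * k) ∂γ)
      = ∫⁻ x, ‖gradient φ x‖ₑ ^ (2 * k) ∂γ := by
    rw [ofReal_integral_eq_lintegral_ofReal hgrad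
      (Filter.Eventually.of_forall fun x => by positivity)]
    exact lintegral_congr fun x => by rw [ENNReal.ofReal_pow (norm_nonneg _), ofReal_norm]
  rw [integral_eq_lintegral_of_nonneg_ae (Filter.Eventually.of_forall fun x => by positivity)
    (by fun_prop)]
  refine ENNReal.toReal_le_of_le_ofReal (by positivity) ?_
  rw [mul_assoc, ENNReal.ofReal_mul (by positivity), ENNReal.ofReal_mul (by positivity),
    ENNReal.ofReal_pow (by positivity), hgradL]
  refine le_trans ?_ (lintegral_enorm_sub_pow_le hφ hk)
  rw [lintegral_prod _ (by fun_prop)]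
  refine lintegral_mono fun x => ?_
  rw [ENNReal.ofReal_pow (abs_nonneg _), ← Real.enorm_eq_ofReal_abs]
  exact hjensen x
end

section
/- Let n ≥ 1 be an integer, M > 0, and let f : ℝⁿ → ℝ be Lipschitz with constant M (i.e. |f(x) − f(y)| ≤ M‖x − y‖ for all x, y). Then for every real λ with 0 ≤ λ < 1/(2M²), the function x ↦ exp(λ·(f(x) − ∫ f dμ)²) is μ-integrable: ∫_{ℝⁿ} exp(λ(f − ∫f dμ)²) dμ < ∞. -/
open MeasureTheory

/-- The Gaussian `v ↦ exp (-b ‖v‖²)` is Lebesgue integrable on a Euclidean space. -/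
theorem integrable_exp_neg_mul_sq_norm {V : Type*} [NormedAddCommGroup V]
    [InnerProductSpace ℝ V] [FiniteDimensional ℝ V] [MeasurableSpace V] [BorelSpace V]
    {b : ℝ} (hb : 0 < b) : Integrable fun v : V => Real.exp (-b * ‖v‖ ^ 2) := by
  have h := (GaussianFourier.integrable_cexp_neg_mul_sq_norm_add (V := V) (b := (b : ℂ))
    (by simpa using hb) 0 0).norm
  refine h.congr (Filter.Eventually.of_forall fun v => ?_)
  simp only [Complex.norm_exp, zero_mul, add_zero]
  congr 1
  norm_cast

/-- Completing the square: if `lam * M ^ 2 < 1 / 2`, the Gaussian exponent dominates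
`lam * (M * t + C) ^ 2`. -/
theorem mul_add_sq_sub_half_sq_le {lam M : ℝ} (C t : ℝ) {b : ℝ} (hb : 0 < b)
    (hb' : lam * M ^ 2 + 2 * b = 1 / 2) :
    lam * (M * t + C) ^ 2 - t ^ 2 / 2 ≤
      -b * t ^ 2 + ((lam * M * C) ^ 2 / b + lam * C ^ 2) := by
  have h : (lam * M * C) ^ 2 / b + b * t ^ 2 - 2 * (lam * M * C) * t
      = (lam * M * C - b * t) ^ 2 / b := by
    field_simp
    ring
  have h' : 0 ≤ (lam * M * C - b * t) ^ 2 / b := by positivity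
  linear_combination h' - h + t ^ 2 * hb'

/-- Exponential integrability of the square of a Lipschitz function
(Fernique-type result). -/
theorem gaussian_exp_square_integrable (n : ℕ) (hn : 1 ≤ n) (M : ℝ) (hM : 0 < M)
    (f : EuclideanSpace ℝ (Fin n) → ℝ)
    (hf : ∀ x y, |f x - f y| ≤ M * ‖x - y‖)
    (lam : ℝ) (hlam0 : 0 ≤ lam) (hlam : lam < 1 / (2 * M ^ 2)) :
    Integrable
      (fun x => Real.exp (lam * (f x - ∫ y, f y ∂stdGaussian n) ^ 2))
      (stdGaussian n) := by
  generalize (∫ y, f y ∂stdGaussian n) = c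
  have hcont : Continuous f :=
    (LipschitzWith.of_dist_le_mul (K := M.toNNReal) fun x y => by
      simpa [Real.dist_eq, dist_eq_norm, hM.le] using hf x y).continuous
  have hlamM : lam * M ^ 2 < 1 / 2 := by
    rw [lt_div_iff₀ (by positivity)] at hlam
    linarith
  obtain ⟨b, hb, hb'⟩ : ∃ b : ℝ, 0 < b ∧ lam * M ^ 2 + 2 * b = 1 / 2 :=
    ⟨(1 / 2 - lam * M ^ 2) / 2, by linarith, by ring⟩
  set C : ℝ := |f 0 - c|
  set K : ℝ := (lam * M * C) ^ 2 / b + lam * C ^ 2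
  set Z : ℝ := (2 * Real.pi) ^ (-(n : ℝ) / 2)
  have hZ : 0 ≤ Z := by positivity
  rw [stdGaussian, integrable_withDensity_iff_integrable_smul' (by fun_prop)
    (Filter.Eventually.of_forall fun _ => ENNReal.ofReal_lt_top)]
  refine ((integrable_exp_neg_mul_sq_norm hb).const_mul (Z * Real.exp K)).mono'
    (Measurable.aestronglyMeasurable ?_) (Filter.Eventually.of_forall fun x => ?_)
  · have := hcont.measurable
    fun_prop
  have habs : |f x - c| ≤ M * ‖x‖ + C := by
    have h0 := hf x 0
    rw [sub_zero] at h0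
    linarith [abs_sub_le (f x) (f 0) c]
  have hsq : (f x - c) ^ 2 ≤ (M * ‖x‖ + C) ^ 2 := by
    rw [← sq_abs]
    gcongr
  rw [ENNReal.toReal_ofReal (by positivity), smul_eq_mul, Real.norm_of_nonneg (by positivity),
    mul_assoc, mul_assoc, ← Real.exp_add, ← Real.exp_add]
  refine mul_le_mul_of_nonneg_left (Real.exp_le_exp.mpr ?_) hZ
  linarith [mul_le_mul_of_nonneg_left hsq hlam0, mul_add_sq_sub_half_sq_le C ‖x‖ hb hb']
end

section
/- Let n ≥ 1 be an integer and suppose that ν satisfies the logarithmic Sobolev inequality with constant K > 0. Let f : ℝⁿ → ℝ be Lipschitz with constant 1. Then f is ν-integrable and, for every t ∈ ℝ, ∫_{ℝⁿ} e^{t f(x)} dν(x) ≤ exp( t·∫ f dν + K t²/4 ). -/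
open MeasureTheory

/-- A Borel probability measure `ν` on `ℝⁿ` satisfies the logarithmic Sobolev
inequality with constant `K` if for every Lipschitz `g` with `0 < ∫ g² dν < ∞`,
`∫ g² log(g²/∫g² dν) dν ≤ K ∫ ‖∇g‖² dν`, where the gradient is taken to be `0`
at points of non-differentiability. -/
def SatisfiesLogSobolev (n : ℕ) (ν : Measure (EuclideanSpace ℝ (Fin n)))
    (K : ℝ) : Prop :=
  ∀ g : EuclideanSpace ℝ (Fin n) → ℝ, (∃ L : NNReal, LipschitzWith L g) →
    Integrable (fun x => (g x) ^ 2) ν → 0 < ∫ x, (g x) ^ 2 ∂ν →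
    ∫ x, (g x) ^ 2 * Real.log ((g x) ^ 2 / ∫ y, (g y) ^ 2 ∂ν) ∂ν
      ≤ K * ∫ x, ‖gradient g x‖ ^ 2 ∂ν

open ProbabilityTheory Filter Topology

/-- The gradient (with value `0` at points of non-differentiability) of `exp ∘ F` is controlled by
the Lipschitz constant of `F`. -/
theorem norm_gradient_exp_le {E : Type*} [NormedAddCommGroup E] [InnerProductSpace ℝ E]
    [CompleteSpace E] {F : E → ℝ} {L : NNReal} (hF : LipschitzWith L F) (x : E) :
    ‖gradient (fun y => Real.exp (F y)) x‖ ≤ L * Real.exp (F x) := by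
  rw [gradient, LinearIsometryEquiv.norm_map]
  by_cases hd : DifferentiableAt ℝ F x
  · rw [fderiv_exp hd, norm_smul, Real.norm_of_nonneg (Real.exp_pos _).le, mul_comm]
    gcongr
    exact norm_fderiv_le_of_lipschitz ℝ hF
  · have hd' : ¬ DifferentiableAt ℝ (fun y => Real.exp (F y)) x := fun h =>
      hd (by simpa using h.log (Real.exp_pos _).ne')
    rw [fderiv_zero_of_not_differentiableAt hd', norm_zero]
    positivity

/-- The exponential of a Lipschitz function that is bounded above is Lipschitz. -/
theorem LipschitzWith.exists_lipschitzWith_exp {E : Type*} [PseudoMetricSpace E] {F : E → ℝ}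
    {L : NNReal} (hF : LipschitzWith L F) {M : ℝ} (hM : ∀ x, F x ≤ M) :
    ∃ C : NNReal, LipschitzWith C fun x => Real.exp (F x) := by
  have hexp : LipschitzOnWith (Real.exp M).toNNReal Real.exp (Set.Iic M) := by
    refine Convex.lipschitzOnWith_of_nnnorm_deriv_le
      (fun x _ => Real.differentiableAt_exp) (fun x hx => ?_) (convex_Iic M)
    rw [← NNReal.coe_le_coe, Real.coe_toNNReal _ (Real.exp_pos M).le, coe_nnnorm, Real.deriv_exp,
      Real.norm_of_nonneg (Real.exp_pos x).le]
    exact Real.exp_le_exp.2 hx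
  exact ⟨_, lipschitzOnWith_univ.1 (hexp.comp (lipschitzOnWith_univ.2 hF) fun x _ => hM x)⟩

/-- Fatou's lemma for sequences of functions that are pointwise eventually equal to `F`. -/
theorem lintegral_le_of_eventually_eq {α : Type*} [MeasurableSpace α] {μ : Measure α}
    {g : ℕ → α → ENNReal} {F : α → ENNReal} {B : ℕ → ENNReal} {b : ENNReal}
    (hg : ∀ k, Measurable (g k)) (hgF : ∀ x, ∀ᶠ k in atTop, g k x = F x)
    (hgB : ∀ k, ∫⁻ x, g k x ∂μ ≤ B k) (hB : Tendsto B atTop (𝓝 b)) :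
    ∫⁻ x, F x ∂μ ≤ b :=
  calc ∫⁻ x, F x ∂μ = ∫⁻ x, liminf (fun k => g k x) atTop ∂μ :=
        lintegral_congr fun x => (Tendsto.liminf_eq
          (tendsto_const_nhds.congr' ((hgF x).mono fun _ hk => hk.symm))).symm
    _ ≤ liminf (fun k => ∫⁻ x, g k x ∂μ) atTop := lintegral_liminf_le hg
    _ ≤ liminf B atTop := liminf_le_liminf (.of_forall hgB)
    _ = b := hB.liminf_eq

namespace SatisfiesLogSobolev

variable {n : ℕ} {ν : Measure (EuclideanSpace ℝ (Fin n))} [IsProbabilityMeasure ν] {K : ℝ}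
  {f : EuclideanSpace ℝ (Fin n) → ℝ} {M : ℝ}

/-- The logarithmic Sobolev inequality applied to `exp (t f / 2)`. -/
theorem entropy_exp_le (hLSI : SatisfiesLogSobolev n ν K) (hK : 0 ≤ K)
    (hf : LipschitzWith 1 f) (hM : ∀ x, |f x| ≤ M) {t : ℝ} (ht : 0 ≤ t) :
    ∫ x, Real.exp (t * f x) * Real.log (Real.exp (t * f x) / ∫ y, Real.exp (t * f y) ∂ν) ∂ν
      ≤ K * (t ^ 2 / 4 * ∫ x, Real.exp (t * f x) ∂ν) := by
  have hint : Integrable (fun x => Real.exp (t * f x)) ν :=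
    integrable_exp_mul_of_mem_Icc hf.continuous.measurable.aemeasurable
      (ae_of_all _ fun x => abs_le.1 (hM x))
  have hF : LipschitzWith (t / 2).toNNReal fun x => t / 2 * f x := by
    refine LipschitzWith.of_dist_le_mul fun x y => ?_
    have := hf.dist_le_mul x y
    rw [Real.dist_eq] at this ⊢
    rw [← mul_sub, abs_mul, abs_of_nonneg (by positivity : 0 ≤ t / 2),
      Real.coe_toNNReal _ (by positivity)]
    gcongr
    simpa using this
  have hsq (x) : Real.exp (t / 2 * f x) ^ 2 = Real.exp (t * f x) := by
    rw [← Real.exp_nat_mul]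
    congr 1
    push_cast
    ring
  have key := hLSI (fun x => Real.exp (t / 2 * f x))
    (hF.exists_lipschitzWith_exp (M := t / 2 * M) fun x => by
      gcongr
      exact (abs_le.1 (hM x)).2)
  simp only [hsq] at key
  refine (key hint (integral_exp_pos hint)).trans ?_
  gcongr
  rw [← integral_const_mul]
  refine integral_mono_of_nonneg (ae_of_all _ fun x => by positivity) (hint.const_mul _)
    (ae_of_all _ fun x => ?_)
  calc ‖gradient (fun y => Real.exp (t / 2 * f y)) x‖ ^ 2
      ≤ ((t / 2).toNNReal * Real.exp (t / 2 * f x)) ^ 2 := by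
        gcongr
        exact norm_gradient_exp_le hF x
    _ = t ^ 2 / 4 * Real.exp (t * f x) := by
        rw [Real.coe_toNNReal _ (by positivity), mul_pow, hsq]
        ring

/-- Herbst's differential inequality for the cumulant generating function. -/
theorem mul_deriv_cgf_sub_le (hLSI : SatisfiesLogSobolev n ν K) (hK : 0 ≤ K)
    (hf : LipschitzWith 1 f) (hM : ∀ x, |f x| ≤ M) {t : ℝ} (ht : 0 ≤ t) :
    t * deriv (cgf f ν) t - cgf f ν t ≤ K * t ^ 2 / 4 := by
  have hint (t : ℝ) : Integrable (fun x => Real.exp (t * f x)) ν :=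
    integrable_exp_mul_of_mem_Icc hf.continuous.measurable.aemeasurable
      (ae_of_all _ fun x => abs_le.1 (hM x))
  have hset : t ∈ interior (integrableExpSet f ν) := by simp [hint, integrableExpSet]
  have hpos : 0 < mgf f ν t := mgf_pos (hint t)
  have hint' : Integrable (fun x => f x * Real.exp (t * f x)) ν := by
    simpa using integrable_pow_mul_exp_of_mem_interior_integrableExpSet hset 1
  have key := hLSI.entropy_exp_le hK hf hM ht
  have hentropy : ∫ x, Real.exp (t * f x) *
      Real.log (Real.exp (t * f x) / ∫ y, Real.exp (t * f y) ∂ν) ∂ν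
      = t * ∫ x, f x * Real.exp (t * f x) ∂ν - cgf f ν t * mgf f ν t := by
    rw [mgf, ← integral_const_mul, ← integral_const_mul,
      ← integral_sub (hint'.const_mul _) ((hint t).const_mul _)]
    refine integral_congr_ae (ae_of_all _ fun x => ?_)
    simp only
    rw [mgf] at hpos
    rw [Real.log_div (Real.exp_pos _).ne' hpos.ne', Real.log_exp, cgf, mgf]
    ring
  rw [hentropy] at key
  change _ ≤ K * (t ^ 2 / 4 * mgf f ν t) at key
  rw [deriv_cgf hset, ← mul_le_mul_iff_left₀ hpos]
  calc _ = t * ∫ x, f x * Real.exp (t * f x) ∂ν - cgf f ν t * mgf f ν t := by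
        field_simp
    _ ≤ _ := key
    _ = _ := by ring

/-- Herbst's bound for bounded functions and positive times. -/
theorem cgf_le_of_pos (hLSI : SatisfiesLogSobolev n ν K) (hK : 0 ≤ K)
    (hf : LipschitzWith 1 f) (hM : ∀ x, |f x| ≤ M) {t : ℝ} (ht : 0 < t) :
    cgf f ν t ≤ t * ∫ x, f x ∂ν + K * t ^ 2 / 4 := by
  have hset (t : ℝ) : t ∈ interior (integrableExpSet f ν) := by
    have hint (t : ℝ) : Integrable (fun x => Real.exp (t * f x)) ν :=
      integrable_exp_mul_of_mem_Icc hf.continuous.measurable.aemeasurable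
        (ae_of_all _ fun x => abs_le.1 (hM x))
    simp [hint, integrableExpSet]
  have hcgf (s : ℝ) : HasDerivAt (cgf f ν) (deriv (cgf f ν) s) s :=
    (analyticAt_cgf (hset s)).differentiableAt.hasDerivAt
  have hderiv (s : ℝ) (hs : 0 < s) : HasDerivAt (fun s => cgf f ν s / s - K / 4 * s)
      ((deriv (cgf f ν) s * s - cgf f ν s * 1) / s ^ 2 - K / 4 * 1) s :=
    ((hcgf s).div (hasDerivAt_id s) hs.ne').sub ((hasDerivAt_id s).const_mul _)
  have hanti : AntitoneOn (fun s => cgf f ν s / s - K / 4 * s) (Set.Ioi 0) := by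
    refine antitoneOn_of_deriv_nonpos (convex_Ioi 0)
      (fun s hs => (hderiv s hs).continuousAt.continuousWithinAt) ?_ ?_ <;>
      rw [interior_Ioi] <;> intro s hs
    · exact (hderiv s hs).differentiableAt.differentiableWithinAt
    · rw [(hderiv s hs).deriv, sub_nonpos, div_le_iff₀ (pow_pos hs 2)]
      linarith [hLSI.mul_deriv_cgf_sub_le hK hf hM (le_of_lt hs)]
  have hlim : Tendsto (fun s => cgf f ν s / s - K / 4 * s) (𝓝[>] 0) (𝓝 (∫ x, f x ∂ν)) := by
    have h := (hcgf 0).tendsto_slope_zero.mono_left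
      (nhdsWithin_mono 0 fun s (hs : 0 < s) => hs.ne')
    have hlin : Tendsto (fun s : ℝ => K / 4 * s) (𝓝[>] 0) (𝓝 0) :=
      ((continuous_const_mul (K / 4)).tendsto' 0 0 (mul_zero _)).mono_left nhdsWithin_le_nhds
    have h' := h.sub hlin
    simp only [deriv_cgf_zero (hset 0), probReal_univ, div_one, sub_zero, zero_add, cgf_zero,
      smul_eq_mul] at h'
    exact h'.congr fun s => by ring
  have hle : cgf f ν t / t - K / 4 * t ≤ ∫ x, f x ∂ν :=
    ge_of_tendsto hlim (by
      filter_upwards [Ioo_mem_nhdsGT ht] with s hs using hanti hs.1 ht hs.2.le)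
  rw [sub_le_iff_le_add, div_le_iff₀ ht] at hle
  linarith

/-- Herbst's bound for bounded functions. -/
theorem lintegral_exp_le_of_bounded (hLSI : SatisfiesLogSobolev n ν K) (hK : 0 ≤ K)
    (hf : LipschitzWith 1 f) (hM : ∀ x, |f x| ≤ M) (t : ℝ) :
    ∫⁻ x, ENNReal.ofReal (Real.exp (t * f x)) ∂ν
      ≤ ENNReal.ofReal (Real.exp (t * ∫ x, f x ∂ν + K * t ^ 2 / 4)) := by
  have hint : Integrable (fun x => Real.exp (t * f x)) ν :=
    integrable_exp_mul_of_mem_Icc hf.continuous.measurable.aemeasurable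
      (ae_of_all _ fun x => abs_le.1 (hM x))
  rw [← ofReal_integral_eq_lintegral_ofReal hint (ae_of_all _ fun x => (Real.exp_pos _).le)]
  refine ENNReal.ofReal_le_ofReal ?_
  change mgf f ν t ≤ _
  rw [← exp_cgf hint, Real.exp_le_exp]
  rcases lt_trichotomy t 0 with ht | rfl | ht
  · have h := hLSI.cgf_le_of_pos hK (f := -f) hf.neg (M := M) (fun x => by simpa using hM x)
      (neg_pos.2 ht)
    rw [cgf_neg, neg_neg] at h
    simpa [integral_neg] using h
  · simp
  · exact hLSI.cgf_le_of_pos hK hf hM ht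

/-- Under a logarithmic Sobolev inequality, `1`-Lipschitz functions are integrable. -/
theorem integrable_of_lipschitzWith (hLSI : SatisfiesLogSobolev n ν K) (hK : 0 ≤ K)
    (hf : LipschitzWith 1 f) : Integrable f ν := by
  have hmeas : Measurable f := hf.continuous.measurable
  have hexp : Integrable (fun x => Real.exp (-|f x|)) ν :=
    Integrable.of_mem_Icc 0 1 (by fun_prop)
      (ae_of_all _ fun x => ⟨(Real.exp_pos _).le, by simp⟩)
  have hc : 0 < ∫ x, Real.exp (-|f x|) ∂ν := integral_exp_pos hexp
  set h : ℕ → EuclideanSpace ℝ (Fin n) → ℝ := fun k x => min |f x| k with h_def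
  have h_nonneg (k x) : 0 ≤ h k x := le_min (abs_nonneg _) k.cast_nonneg
  have h_bdd (k x) : |h k x| ≤ k := by
    rw [abs_of_nonneg (h_nonneg k x)]
    exact min_le_right _ _
  have h_lip (k) : LipschitzWith 1 (h k) := by
    have habs : LipschitzWith 1 fun x => |f x| := by
      simpa using! lipschitzWith_one_norm.comp hf
    exact habs.min_const k
  have h_int (k) : Integrable (h k) ν :=
    Integrable.of_mem_Icc 0 k (h_lip k).continuous.measurable.aemeasurable
      (ae_of_all _ fun x => ⟨h_nonneg k x, min_le_right _ _⟩)
  have h_bound (k) : ∫ x, h k x ∂ν ≤ K / 4 - Real.log (∫ x, Real.exp (-|f x|) ∂ν) := by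
    have hle := hLSI.lintegral_exp_le_of_bounded hK (h_lip k) (h_bdd k) (-1)
    have hmono : ENNReal.ofReal (∫ x, Real.exp (-|f x|) ∂ν)
        ≤ ∫⁻ x, ENNReal.ofReal (Real.exp (-1 * h k x)) ∂ν := by
      rw [ofReal_integral_eq_lintegral_ofReal hexp (ae_of_all _ fun x => (Real.exp_pos _).le)]
      refine lintegral_mono fun x => ENNReal.ofReal_le_ofReal (Real.exp_le_exp.2 ?_)
      rw [neg_one_mul, neg_le_neg_iff]
      exact min_le_left _ _
    have := (ENNReal.ofReal_le_ofReal_iff (Real.exp_pos _).le).1 (hmono.trans hle)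
    have := (Real.log_le_iff_le_exp hc).2 this
    linarith
  refine ⟨hmeas.aestronglyMeasurable, ?_⟩
  rw [hasFiniteIntegral_iff_norm]
  refine lt_of_le_of_lt ?_ (ENNReal.ofReal_lt_top
    (r := K / 4 - Real.log (∫ x, Real.exp (-|f x|) ∂ν)))
  refine lintegral_le_of_eventually_eq (g := fun k x => ENNReal.ofReal (h k x))
    (fun k => (h_lip k).continuous.measurable.ennreal_ofReal) (fun x => ?_) (fun k => ?_)
    tendsto_const_nhds
  · filter_upwards [eventually_ge_atTop ⌈|f x|⌉₊] with k hk
    simp only [h_def]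
    rw [min_eq_left (Nat.ceil_le.1 hk), Real.norm_eq_abs]
  · rw [← ofReal_integral_eq_lintegral_ofReal (h_int k) (ae_of_all _ (h_nonneg k))]
    exact ENNReal.ofReal_le_ofReal (h_bound k)

end SatisfiesLogSobolev

/-- Herbst's argument: the log-Sobolev inequality implies a Gaussian bound on
the Laplace transform of `1`-Lipschitz functions. -/
theorem logSobolev_laplace_bound (n : ℕ) (hn : 1 ≤ n)
    (ν : Measure (EuclideanSpace ℝ (Fin n))) [IsProbabilityMeasure ν]
    (K : ℝ) (hK : 0 < K) (hLSI : SatisfiesLogSobolev n ν K)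
    (f : EuclideanSpace ℝ (Fin n) → ℝ) (hf : LipschitzWith 1 f) :
    Integrable f ν ∧
      ∀ t : ℝ,
        ∫⁻ x, ENNReal.ofReal (Real.exp (t * f x)) ∂ν
          ≤ ENNReal.ofReal (Real.exp (t * ∫ x, f x ∂ν + K * t ^ 2 / 4)) := by
  have hint := hLSI.integrable_of_lipschitzWith hK.le hf
  refine ⟨hint, fun t => ?_⟩
  set h : ℕ → EuclideanSpace ℝ (Fin n) → ℝ := fun k x => max (-(k : ℝ)) (min (f x) k) with h_def
  have h_lip (k) : LipschitzWith 1 (h k) := (hf.min_const k).const_max _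
  have h_bdd (k x) : |h k x| ≤ k :=
    abs_le.2 ⟨le_max_left _ _, max_le (by simp) (min_le_right _ _)⟩
  have h_abs (k x) : |h k x| ≤ |f x| := by
    have hk : (0 : ℝ) ≤ k := k.cast_nonneg
    refine abs_le.2 ⟨le_max_of_le_right (le_min (neg_abs_le _) ?_),
      max_le ?_ ((min_le_left _ _).trans (le_abs_self _))⟩ <;>
      linarith [abs_nonneg (f x)]
  have h_eq (x) : ∀ᶠ k in atTop, h k x = f x := by
    filter_upwards [eventually_ge_atTop ⌈|f x|⌉₊] with k hk
    have hk' := abs_le.1 (Nat.ceil_le.1 hk)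
    simp only [h_def]
    rw [min_eq_left hk'.2, max_eq_right hk'.1]
  have h_mean : Tendsto (fun k => ∫ x, h k x ∂ν) atTop (𝓝 (∫ x, f x ∂ν)) :=
    tendsto_integral_of_dominated_convergence (fun x => |f x|)
      (fun k => (h_lip k).continuous.aestronglyMeasurable) hint.abs
      (fun k => ae_of_all _ (h_abs k))
      (ae_of_all _ fun x => tendsto_const_nhds.congr' ((h_eq x).mono fun _ hk => hk.symm))
  have h_rhs : Tendsto
      (fun k => ENNReal.ofReal (Real.exp (t * ∫ x, h k x ∂ν + K * t ^ 2 / 4))) atTop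
      (𝓝 (ENNReal.ofReal (Real.exp (t * ∫ x, f x ∂ν + K * t ^ 2 / 4)))) :=
    ENNReal.tendsto_ofReal ((Real.continuous_exp.tendsto _).comp
      ((h_mean.const_mul t).add_const _))
  refine lintegral_le_of_eventually_eq (fun k => ?_)
    (fun x => (h_eq x).mono fun k hk => by rw [hk])
    (fun k => hLSI.lintegral_exp_le_of_bounded hK.le (h_lip k) (h_bdd k) t) h_rhs
  have := (h_lip k).continuous.measurable
  fun_prop
end

section
/- Let n ≥ 1 be an integer and let f : ℝⁿ → [0, +∞] be a Borel function that is finite on some set of positive Lebesgue measure. Suppose that for every u ∈ ℝⁿ the inequality f(x) ≤ (f(x+u) + f(x−u))/2 holds for Lebesgue-almost every x ∈ ℝⁿ (the exceptional null set may depend on u). Then there exists a nonempty open convex set U ⊆ ℝⁿ such that f is locally essentially bounded on U (every point of U has a neighborhood on which f is Lebesgue-essentially bounded) and f = +∞ Lebesgue-almost everywhere on the complement of the closure of U. -/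
open MeasureTheory
open scoped ENNReal

open Set Filter Topology Metric

theorem IsClosed.convex_of_midpoint_mem {E : Type*} [NormedAddCommGroup E] [NormedSpace ℝ E]
    {s : Set E} (hs : IsClosed s) (hmid : ∀ x ∈ s, ∀ y ∈ s, midpoint ℝ x y ∈ s) :
    Convex ℝ s := by
  rw [convex_iff_segment_subset]
  intro x hx y hy
  rw [segment_eq_image_lineMap]
  rintro _ ⟨t, ⟨ht0, ht1⟩, rfl⟩
  by_contra ht
  have hcont : Continuous fun t : ℝ => AffineMap.lineMap x y t := AffineMap.lineMap_continuous
  have hT : IsClosed {t : ℝ | AffineMap.lineMap x y t ∈ s} := hs.preimage hcont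
  obtain ⟨a, ⟨⟨ha0, hat⟩, has⟩, ha⟩ := (isCompact_Icc.inter_right hT).exists_isGreatest
    (⟨0, ⟨le_rfl, ht0⟩, by simpa using hx⟩ : (Icc 0 t ∩ _).Nonempty)
  obtain ⟨b, ⟨⟨hbt, hb1⟩, hbs⟩, hb⟩ := (isCompact_Icc.inter_right hT).exists_isLeast
    (⟨1, ⟨ht1, le_rfl⟩, by simpa using hy⟩ : (Icc t 1 ∩ _).Nonempty)
  have hat' : a < t := lt_of_le_of_ne hat (by rintro rfl; exact ht has)
  have hbt' : t < b := lt_of_le_of_ne hbt (by rintro rfl; exact ht hbs)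
  have hm : AffineMap.lineMap x y ((a + b) / 2) ∈ s := by
    have := hmid _ has _ hbs
    rw [← AffineMap.map_midpoint] at this
    convert this using 2
    rw [midpoint_eq_smul_add, smul_eq_mul, invOf_eq_inv]
    ring
  rcases le_total ((a + b) / 2) t with h | h
  · have := ha ⟨⟨by linarith, h⟩, hm⟩
    linarith
  · have := hb ⟨⟨h, by linarith⟩, hm⟩
    linarith

theorem IsOpen.convex_of_midpoint_mem {E : Type*} [NormedAddCommGroup E] [NormedSpace ℝ E]
    {s : Set E} (hs : IsOpen s) (hmid : ∀ x ∈ s, ∀ y ∈ s, midpoint ℝ x y ∈ s) :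
    Convex ℝ s := by
  have hclosure : Convex ℝ (closure s) :=
    isClosed_closure.convex_of_midpoint_mem fun x hx y hy =>
      map_mem_closure₂ (f := fun x y : E => midpoint ℝ x y)
        (by simp only [midpoint_eq_smul_add]; fun_prop) hx hy hmid
  suffices interior (closure s) ⊆ s by
    rw [← this.antisymm hs.subset_interior_closure]
    exact hclosure.interior
  intro p hp
  -- The reflection of `s` through `p` is open and meets `s` near `p`.
  have hrefl : Continuous fun x : E => (2 : ℝ) • p - x := by fun_prop
  have hpp : (2 : ℝ) • p - p = p := by rw [two_smul]; abel
  set N := interior (closure s) ∩ (fun x => (2 : ℝ) • p - x) ⁻¹' interior (closure s)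
  have hN : IsOpen N := isOpen_interior.inter (isOpen_interior.preimage hrefl)
  have hpN : p ∈ N := ⟨hp, by simpa only [mem_preimage, hpp] using hp⟩
  obtain ⟨x, hxN, hxs⟩ := mem_closure_iff.1 (interior_subset hp) N hN hpN
  obtain ⟨y, ⟨hyN, hys⟩, hy⟩ := mem_closure_iff.1 (interior_subset hxN.2) _
    (hN.inter (hs.preimage hrefl))
    ⟨⟨hxN.2, by simpa using hxN.1⟩, by simpa using hxs⟩
  have := hmid _ hys _ hy
  rwa [midpoint_eq_smul_add, sub_add_cancel, smul_smul, invOf_mul_self, one_smul] at this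

section Lebesgue

variable {E : Type*} [NormedAddCommGroup E] [NormedSpace ℝ E]
  [MeasurableSpace E] [BorelSpace E] (μ : Measure E) [μ.IsAddHaarMeasure]

/-- Near almost every point of a measurable set `A`, all points are midpoints of many pairs of
points of `A`. -/
theorem ae_eventually_measure_add_mem_sub_mem_pos [FiniteDimensional ℝ E] {A : Set E}
    (hA : MeasurableSet A) :
    ∀ᵐ x ∂μ, x ∈ A → ∀ᶠ w in 𝓝 x, 0 < μ {u | w + u ∈ A ∧ w - u ∈ A} := by
  rw [← ae_restrict_iff' hA]
  filter_upwards [Besicovitch.ae_tendsto_measure_inter_div μ A] with x hx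
  obtain ⟨r, hr, hr0⟩ := ((hx.eventually (lt_mem_nhds ENNReal.one_half_lt_one)).and
    self_mem_nhdsWithin).exists
  replace hr0 : 0 < r := hr0
  set B := A ∩ closedBall x r
  have hB : MeasurableSet B := hA.inter measurableSet_closedBall
  have hball : μ (closedBall x r) < μ B + μ B := by
    have h0 : μ (closedBall x r) ≠ 0 := (measure_closedBall_pos μ x hr0).ne'
    have htop : μ (closedBall x r) ≠ ∞ := measure_closedBall_lt_top.ne
    rw [ENNReal.lt_div_iff_mul_lt (.inl h0) (.inl htop)] at hr
    calc μ (closedBall x r) = 2⁻¹ * μ (closedBall x r) + 2⁻¹ * μ (closedBall x r) := by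
          rw [← add_mul, ENNReal.inv_two_add_inv_two, one_mul]
      _ < μ B + μ B := ENNReal.add_lt_add hr hr
  have hlim : Tendsto (fun w => μ (closedBall (0 : E) (r + dist w x))) (𝓝 x)
      (𝓝 (μ (closedBall x r))) := by
    have heq : ∀ w, μ (closedBall (0 : E) (r + dist w x)) =
        ENNReal.ofReal ((r + dist w x) ^ Module.finrank ℝ E) * μ (ball 0 1) := fun w =>
      Measure.addHaar_closedBall μ 0 (by positivity)
    simp only [heq]
    rw [Measure.addHaar_closedBall μ x hr0.le]
    refine ENNReal.Tendsto.mul_const (ENNReal.tendsto_ofReal ?_) (.inr measure_ball_lt_top.ne)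
    have : Continuous fun w => (r + dist w x) ^ Module.finrank ℝ E := by fun_prop
    simpa using this.tendsto x
  filter_upwards [hlim.eventually (gt_mem_nhds hball)] with w hw
  set S := (fun u => w + u) ⁻¹' B
  set T := (fun u => w - u) ⁻¹' B
  have hS : μ S = μ B := measure_preimage_add μ w B
  have hT : μ T = μ B :=
    (μ.measurePreserving_sub_left w).measure_preimage hB.nullMeasurableSet
  have hST : S ∪ T ⊆ closedBall 0 (r + dist w x) := by
    rintro u (hu | hu)
    · have h1 : dist (w + u) x ≤ r := hu.2
      rw [mem_closedBall, dist_zero_right]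
      calc ‖u‖ = ‖(w + u - x) - (w - x)‖ := by congr 1; abel
        _ ≤ ‖w + u - x‖ + ‖w - x‖ := norm_sub_le _ _
        _ ≤ _ := by rw [← dist_eq_norm, ← dist_eq_norm]; gcongr
    · have h1 : dist (w - u) x ≤ r := hu.2
      rw [mem_closedBall, dist_zero_right]
      calc ‖u‖ = ‖(w - u - x) - (w - x)‖ := by rw [← norm_neg]; congr 1; abel
        _ ≤ ‖w - u - x‖ + ‖w - x‖ := norm_sub_le _ _
        _ ≤ _ := by rw [← dist_eq_norm, ← dist_eq_norm]; gcongr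
  have hTm : MeasurableSet T := (by fun_prop : Measurable fun u => w - u) hB
  have hpos : 0 < μ (S ∩ T) := by
    rw [pos_iff_ne_zero]
    intro h0
    have := measure_union_add_inter S hTm (μ := μ)
    rw [h0, add_zero, hS, hT] at this
    exact ((measure_mono hST).trans_lt hw).ne this
  exact hpos.trans_le (measure_mono fun u hu => ⟨hu.1.1, hu.2.1⟩)

variable {f : E → ℝ≥0∞}

theorem ae_exists_essentially_bounded_nhds_of_midpoint_convex [FiniteDimensional ℝ E]
    (hf : Measurable f)
    (hconv : ∀ u, ∀ᵐ x ∂μ, f x ≤ (f (x + u) + f (x - u)) / 2) :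
    ∀ᵐ x ∂μ, f x ≠ ∞ → ∃ V ∈ 𝓝 x, ∃ C : ℝ≥0∞, C ≠ ∞ ∧ ∀ᵐ y ∂μ, y ∈ V → f y ≤ C := by
  have hmeas : MeasurableSet {p : E × E | f p.2 ≤ (f (p.2 + p.1) + f (p.2 - p.1)) / 2} :=
    measurableSet_le (by fun_prop) (by fun_prop)
  have hswap : ∀ᵐ x ∂μ, ∀ᵐ u ∂μ, f x ≤ (f (x + u) + f (x - u)) / 2 :=
    (Measure.ae_ae_comm hmeas).1 (ae_of_all μ hconv)
  have hlevel := ae_all_iff.2 fun m : ℕ =>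
    ae_eventually_measure_add_mem_sub_mem_pos μ (hf (measurableSet_Iic (a := (m : ℝ≥0∞))))
  filter_upwards [hlevel] with x hx hfx
  obtain ⟨m, hm⟩ := ENNReal.exists_nat_gt hfx
  refine ⟨_, hx m hm.le, m, ENNReal.natCast_ne_top m, ?_⟩
  filter_upwards [hswap] with w hw hwpos
  obtain ⟨u, ⟨hu1, hu2⟩, hu⟩ := ((frequently_ae_mem_iff.2 hwpos.ne').and_eventually hw).exists
  calc f w ≤ (f (w + u) + f (w - u)) / 2 := hu
    _ ≤ (m + m) / 2 := by gcongr <;> assumption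
    _ = m := by rw [ENNReal.add_div, ENNReal.add_halves]

theorem exists_essentially_bounded_nhds_midpoint
    (hconv : ∀ u, ∀ᵐ x ∂μ, f x ≤ (f (x + u) + f (x - u)) / 2) {a b : E}
    (ha : ∃ V ∈ 𝓝 a, ∃ C : ℝ≥0∞, C ≠ ∞ ∧ ∀ᵐ y ∂μ, y ∈ V → f y ≤ C)
    (hb : ∃ V ∈ 𝓝 b, ∃ C : ℝ≥0∞, C ≠ ∞ ∧ ∀ᵐ y ∂μ, y ∈ V → f y ≤ C) :
    ∃ V ∈ 𝓝 (midpoint ℝ a b), ∃ C : ℝ≥0∞, C ≠ ∞ ∧ ∀ᵐ y ∂μ, y ∈ V → f y ≤ C := by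
  obtain ⟨V, hV, C, hC, hVC⟩ := ha
  obtain ⟨W, hW, D, hD, hWD⟩ := hb
  set u : E := midpoint ℝ a b - a
  have hadd : midpoint ℝ a b + u = b := by
    rw [← add_sub_assoc, midpoint_add_self, add_sub_cancel_left]
  have hsub : midpoint ℝ a b - u = a := sub_sub_cancel _ _
  have hW' : (fun x => x + u) ⁻¹' W ∈ 𝓝 (midpoint ℝ a b) :=
    (by fun_prop : Continuous fun x => x + u).continuousAt.preimage_mem_nhds (by rwa [hadd])
  have hV' : (fun x => x - u) ⁻¹' V ∈ 𝓝 (midpoint ℝ a b) :=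
    (by fun_prop : Continuous fun x => x - u).continuousAt.preimage_mem_nhds (by rwa [hsub])
  refine ⟨_, inter_mem hW' hV', (D + C) / 2,
    ENNReal.div_ne_top (ENNReal.add_ne_top.2 ⟨hD, hC⟩) two_ne_zero, ?_⟩
  filter_upwards [hconv u, (measurePreserving_add_right μ u).quasiMeasurePreserving.ae hWD,
    (measurePreserving_sub_right μ u).quasiMeasurePreserving.ae hVC] with x hx hxW hxV hxm
  refine hx.trans ?_
  gcongr
  exacts [hxW hxm.1, hxV hxm.2]

end Lebesgue

/-- If a Borel function `f : ℝⁿ → [0,∞]`, finite on a set of positive Lebesgue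
measure, satisfies the a.e. midpoint convexity condition
`f(x) ≤ (f(x+u) + f(x-u))/2`, then there is a nonempty open convex set `U` on
which `f` is locally essentially bounded, and `f = ∞` a.e. outside of the
closure of `U`. -/
theorem midpoint_convex_locally_bounded (n : ℕ) (hn : 1 ≤ n)
    (f : EuclideanSpace ℝ (Fin n) → ℝ≥0∞) (hf : Measurable f)
    (hfin : 0 < volume {x | f x ≠ ∞})
    (hconv : ∀ u : EuclideanSpace ℝ (Fin n),
      ∀ᵐ x ∂(volume : Measure (EuclideanSpace ℝ (Fin n))),
        f x ≤ (f (x + u) + f (x - u)) / 2) :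
    ∃ U : Set (EuclideanSpace ℝ (Fin n)),
      IsOpen U ∧ U.Nonempty ∧ Convex ℝ U ∧
      (∀ x ∈ U, ∃ V ∈ nhds x, ∃ C : ℝ≥0∞, C ≠ ∞ ∧
        ∀ᵐ y ∂(volume : Measure (EuclideanSpace ℝ (Fin n))), y ∈ V → f y ≤ C) ∧
      (∀ᵐ x ∂(volume : Measure (EuclideanSpace ℝ (Fin n))),
        x ∉ closure U → f x = ∞) := by
  set U : Set (EuclideanSpace ℝ (Fin n)) := {x | ∃ V ∈ 𝓝 x, ∃ C : ℝ≥0∞, C ≠ ∞ ∧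
    ∀ᵐ y ∂(volume : Measure (EuclideanSpace ℝ (Fin n))), y ∈ V → f y ≤ C}
  have hopen : IsOpen U := by
    refine isOpen_iff_mem_nhds.2 fun x ⟨V, hV, C, hC, hVC⟩ => ?_
    filter_upwards [eventually_mem_nhds_iff.2 hV] with y hy using ⟨V, hy, C, hC, hVC⟩
  have hae := ae_exists_essentially_bounded_nhds_of_midpoint_convex volume hf hconv
  refine ⟨U, hopen, ?_, ?_, fun x hx => hx, ?_⟩
  · obtain ⟨x, hx, hxU⟩ := ((frequently_ae_mem_iff.2 hfin.ne').and_eventually hae).exists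
    exact ⟨x, hxU hx⟩
  · exact hopen.convex_of_midpoint_mem fun x hx y hy =>
      exists_essentially_bounded_nhds_midpoint volume hconv hx hy
  · filter_upwards [hae] with x hx hxU
    by_contra h
    exact hxU (subset_closure (hx h))
end

section
/- Let n ≥ 1 be an integer and let g : ℝⁿ → (−∞, +∞] be a Borel measurable function such that for all x, y ∈ ℝⁿ and all α ∈ [0,1], the inequality g(u + αx + (1−α)y) ≤ α·g(u+x) + (1−α)·g(u+y) holds for Lebesgue-almost every u ∈ ℝⁿ (the exceptional null set may depend on x, y and α). Then g has a convex modification: there exists a convex function g′ : ℝⁿ → (−∞, +∞] such that g = g′ Lebesgue-almost everywhere. -/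
open MeasureTheory

open Filter Topology Metric Set

section DensityUpperLimit

variable {E : Type*} [NormedAddCommGroup E] [MeasurableSpace E]

/-- The set `B` has Lebesgue density zero at the point `x`. -/
def HasDensityZero (μ : Measure E) (B : Set E) (x : E) : Prop :=
  Tendsto (fun r => μ (B ∩ closedBall x r) / μ (closedBall x r)) (𝓝[>] 0) (𝓝 0)

/-- The approximate upper limit of `g` at `x`: the infimum of the levels `t` such that
`{g ≥ t}` has density zero at `x`. -/
noncomputable def approxLimsup (μ : Measure E) (g : E → EReal) (x : E) : EReal :=
  ⨅ (t : ℝ) (_ : HasDensityZero μ {u | (t : EReal) ≤ g u} x), (t : EReal)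

lemma HasDensityZero.mono {μ : Measure E} {A B : Set E} {x : E}
    (hB : HasDensityZero μ B x) (h : A ⊆ B) : HasDensityZero μ A x :=
  tendsto_of_tendsto_of_tendsto_of_le_of_le tendsto_const_nhds hB (fun _ => zero_le)
    (fun _ => ENNReal.div_le_div_right (measure_mono (inter_subset_inter_left _ h)) _)

lemma approxLimsup_le {μ : Measure E} {g : E → EReal} {x : E} {t : ℝ}
    (h : HasDensityZero μ {u | (t : EReal) ≤ g u} x) : approxLimsup μ g x ≤ t :=
  iInf₂_le t h

lemma HasDensityZero.of_approxLimsup_lt {μ : Measure E} {g : E → EReal} {x : E} {t : ℝ}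
    (h : approxLimsup μ g x < t) : HasDensityZero μ {u | (t : EReal) ≤ g u} x := by
  simp only [approxLimsup, iInf_lt_iff] at h
  obtain ⟨s, hs, hst⟩ := h
  exact hs.mono fun u hu => hst.le.trans hu

variable [BorelSpace E]

lemma measure_inter_closedBall_eq_translate (μ : Measure E) [μ.IsAddLeftInvariant]
    (B : Set E) (x : E) (r : ℝ) :
    μ (B ∩ closedBall x r) = μ ((x + ·) ⁻¹' B ∩ closedBall 0 r) := by
  rw [← measure_preimage_add μ x (B ∩ closedBall x r), preimage_inter, preimage_add_closedBall,
    sub_self]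

lemma measure_closedBall_eq_translate (μ : Measure E) [μ.IsAddLeftInvariant] (x : E) (r : ℝ) :
    μ (closedBall x r) = μ (closedBall 0 r) := by
  simpa using measure_inter_closedBall_eq_translate μ univ x r

lemma HasDensityZero.of_ae_translate {μ : Measure E} [μ.IsAddLeftInvariant]
    {A B C : Set E} {x y z : E} (hA : HasDensityZero μ A x) (hB : HasDensityZero μ B y)
    (h : ∀ᵐ u ∂μ, z + u ∈ C → x + u ∈ A ∨ y + u ∈ B) : HasDensityZero μ C z := by
  have hsum := hA.add hB
  rw [add_zero] at hsum
  refine tendsto_of_tendsto_of_tendsto_of_le_of_le tendsto_const_nhds hsum (fun _ => zero_le)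
    fun r => ?_
  simp only [measure_closedBall_eq_translate μ x, measure_closedBall_eq_translate μ y,
    measure_closedBall_eq_translate μ z, measure_inter_closedBall_eq_translate μ _ x,
    measure_inter_closedBall_eq_translate μ _ y, measure_inter_closedBall_eq_translate μ _ z]
  rw [← ENNReal.add_div]
  refine ENNReal.div_le_div_right ((measure_mono_ae ?_).trans (measure_union_le _ _)) _
  filter_upwards [h] with u hu hmem
  exact (hu hmem.1).imp (fun h' => ⟨h', hmem.2⟩) (fun h' => ⟨h', hmem.2⟩)

variable [NormedSpace ℝ E] [FiniteDimensional ℝ E]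

lemma ae_hasDensityZero_iff_notMem (μ : Measure E) [IsLocallyFiniteMeasure μ] {B : Set E}
    (hB : MeasurableSet B) : ∀ᵐ x ∂μ, HasDensityZero μ B x ↔ x ∉ B := by
  have := FiniteDimensional.proper ℝ E
  filter_upwards [Besicovitch.ae_tendsto_measure_inter_div_of_measurableSet μ hB] with x hx
  refine ⟨fun h hxB => ?_, fun h => ?_⟩
  · rw [indicator_of_mem hxB] at hx
    exact zero_ne_one (tendsto_nhds_unique h hx)
  · rwa [indicator_of_notMem h] at hx

lemma ae_eq_approxLimsup (μ : Measure E) [IsLocallyFiniteMeasure μ] {g : E → EReal}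
    (hg : Measurable g) : g =ᵐ[μ] approxLimsup μ g := by
  have h : ∀ q : ℚ, ∀ᵐ x ∂μ,
      HasDensityZero μ {u | ((q : ℝ) : EReal) ≤ g u} x ↔ x ∉ {u | ((q : ℝ) : EReal) ≤ g u} :=
    fun q => ae_hasDensityZero_iff_notMem μ (measurableSet_le measurable_const hg)
  filter_upwards [ae_all_iff.2 h] with x hx
  simp only [not_le] at hx
  apply le_antisymm
  · by_contra! hlt
    obtain ⟨q, hq, hqg⟩ := EReal.lt_iff_exists_rat_btwn.1 hlt
    exact lt_asymm ((hx q).1 (.of_approxLimsup_lt hq)) hqg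
  · by_contra! hlt
    obtain ⟨q, hq, hqg⟩ := EReal.lt_iff_exists_rat_btwn.1 hlt
    exact hqg.not_ge (approxLimsup_le ((hx q).2 hq))

end DensityUpperLimit

lemma EReal.combo_lt_of_lt {a b : EReal} {s t α : ℝ} (ha : a ≠ ⊥) (hb : b ≠ ⊥)
    (h0 : 0 < α) (h1 : α < 1) (has : a < s) (hbt : b < t) :
    (α : EReal) * a + ((1 - α : ℝ) : EReal) * b < ((α * s + (1 - α) * t : ℝ) : EReal) := by
  lift a to ℝ using ⟨has.ne_top, ha⟩
  lift b to ℝ using ⟨hbt.ne_top, hb⟩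
  rw [EReal.coe_lt_coe_iff] at has hbt
  norm_cast
  have := _root_.sub_pos.2 h1
  gcongr

lemma EReal.le_combo_of_forall_lt {a b c : EReal} {α : ℝ} (ha : a ≠ ⊥) (hb : b ≠ ⊥)
    (h0 : 0 < α) (h1 : α < 1)
    (h : ∀ s t : ℝ, a < s → b < t → c ≤ ((α * s + (1 - α) * t : ℝ) : EReal)) :
    c ≤ (α : EReal) * a + ((1 - α : ℝ) : EReal) * b := by
  have h1' : 0 < 1 - α := _root_.sub_pos.2 h1
  have mul_ne_bot : ∀ {r : ℝ} {d : EReal}, 0 < r → d ≠ ⊥ → (r : EReal) * d ≠ ⊥ := by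
    intro r d hr hd
    induction d with
    | bot => exact absurd rfl hd
    | coe d => exact_mod_cast EReal.coe_ne_bot (r * d)
    | top => simp [EReal.coe_mul_top_of_pos hr]
  induction a with
  | bot => exact absurd rfl ha
  | top =>
    rw [EReal.coe_mul_top_of_pos h0, EReal.top_add_of_ne_bot (mul_ne_bot h1' hb)]
    exact le_top
  | coe a =>
    induction b with
    | bot => exact absurd rfl hb
    | top =>
      rw [EReal.coe_mul_top_of_pos h1', EReal.add_top_of_ne_bot (mul_ne_bot h0 ha)]
      exact le_top
    | coe b =>
      refine EReal.le_of_forall_lt_iff_le.1 fun z hz => ?_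
      norm_cast at hz
      have hε : 0 < z - (α * a + (1 - α) * b) := _root_.sub_pos.2 hz
      refine (h (a + (z - (α * a + (1 - α) * b))) (b + (z - (α * a + (1 - α) * b)))
        (by exact_mod_cast lt_add_of_pos_right a hε)
        (by exact_mod_cast lt_add_of_pos_right b hε)).trans_eq ?_
      norm_cast
      ring

section Convexity

variable {E : Type*} [NormedAddCommGroup E] [NormedSpace ℝ E] [MeasurableSpace E] [BorelSpace E]

lemma approxLimsup_combo_le {μ : Measure E} [μ.IsAddLeftInvariant] {g : E → EReal}
    (hbot : ∀ x, g x ≠ ⊥) {x y : E} {α : ℝ} (h0 : 0 < α) (h1 : α < 1)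
    (hconv : ∀ᵐ u ∂μ, g (u + α • x + (1 - α) • y)
      ≤ (α : EReal) * g (u + x) + ((1 - α : ℝ) : EReal) * g (u + y))
    {s t : ℝ} (hs : approxLimsup μ g x < s) (ht : approxLimsup μ g y < t) :
    approxLimsup μ g (α • x + (1 - α) • y) ≤ ((α * s + (1 - α) * t : ℝ) : EReal) := by
  refine approxLimsup_le (HasDensityZero.of_ae_translate (.of_approxLimsup_lt hs)
    (.of_approxLimsup_lt ht) ?_)
  filter_upwards [hconv] with u hu hmem
  by_contra! hcon
  rw [add_assoc, add_comm u, add_comm u, add_comm u] at hu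
  exact (hmem.trans hu).not_gt (EReal.combo_lt_of_lt (hbot _) (hbot _) h0 h1 hcon.1 hcon.2)

/-- A function that is finite on a set of positive measure, takes the value `⊥` only on a null set
and is midpoint convex (with finite upper bounds) never takes the value `⊥`. -/
lemma ne_bot_of_midpoint_le [FiniteDimensional ℝ E] {μ : Measure E} [μ.IsAddHaarMeasure]
    {f : E → EReal} (hbot : ∀ᵐ x ∂μ, f x ≠ ⊥) (htop : ¬ ∀ᵐ x ∂μ, f x = ⊤)
    (hmid : ∀ x y : E, ∀ s t : ℝ, f x < s → f y < t →
      f ((1 / 2 : ℝ) • x + (1 - 1 / 2 : ℝ) • y)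
        ≤ ((1 / 2 * s + (1 - 1 / 2) * t : ℝ) : EReal)) (x : E) : f x ≠ ⊥ := by
  intro hx
  refine htop ?_
  have hsub : AffineMap.homothety x (1 / 2 : ℝ) '' {y | f y ≠ ⊤} ⊆ {z | ¬ f z ≠ ⊥} := by
    rintro _ ⟨y, hy, rfl⟩
    obtain ⟨t, ht, -⟩ := EReal.lt_iff_exists_real_btwn.1 (lt_top_iff_ne_top.2 hy)
    have hz : AffineMap.homothety x (1 / 2 : ℝ) y
        = (1 / 2 : ℝ) • x + (1 - 1 / 2 : ℝ) • y := by
      rw [AffineMap.homothety_apply, vsub_eq_sub, vadd_eq_add]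
      module
    rw [mem_ofPred_eq, not_not, hz, EReal.eq_bot_iff_forall_lt]
    intro c
    refine (hmid x y (2 * (c - 1) - t) t (hx ▸ EReal.bot_lt_coe _) ht).trans_lt ?_
    norm_cast
    linarith
  have hnull := measure_mono_null hsub (ae_iff.1 hbot)
  rw [Measure.addHaar_image_homothety, mul_eq_zero] at hnull
  refine ae_iff.2 (hnull.resolve_left ?_)
  simp

end Convexity

/-- A measurable function `g : ℝⁿ → (-∞, +∞]` which is almost surely convex
(in the sense that each convexity inequality along fixed directions holds
Lebesgue-almost everywhere) admits a convex modification. -/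
theorem ae_convex_modification (n : ℕ) (hn : 1 ≤ n)
    (g : EuclideanSpace ℝ (Fin n) → EReal) (hg : Measurable g)
    (hbot : ∀ x, g x ≠ ⊥)
    (hconv : ∀ x y : EuclideanSpace ℝ (Fin n), ∀ α : ℝ, α ∈ Set.Icc (0 : ℝ) 1 →
      ∀ᵐ u ∂(volume : Measure (EuclideanSpace ℝ (Fin n))),
        g (u + α • x + (1 - α) • y)
          ≤ (α : EReal) * g (u + x) + ((1 - α : ℝ) : EReal) * g (u + y)) :
    ∃ g' : EuclideanSpace ℝ (Fin n) → EReal,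
      (∀ x, g' x ≠ ⊥) ∧
      (∀ x y : EuclideanSpace ℝ (Fin n), ∀ α : ℝ, α ∈ Set.Icc (0 : ℝ) 1 →
        g' (α • x + (1 - α) • y)
          ≤ (α : EReal) * g' x + ((1 - α : ℝ) : EReal) * g' y) ∧
      g =ᵐ[(volume : Measure (EuclideanSpace ℝ (Fin n)))] g' := by
  suffices h : ∃ g' : EuclideanSpace ℝ (Fin n) → EReal, (∀ x, g' x ≠ ⊥) ∧
      (∀ x y : EuclideanSpace ℝ (Fin n), ∀ α : ℝ, 0 < α → α < 1 → ∀ s t : ℝ, g' x < s → g' y < t →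
        g' (α • x + (1 - α) • y) ≤ ((α * s + (1 - α) * t : ℝ) : EReal)) ∧
      g =ᵐ[(volume : Measure (EuclideanSpace ℝ (Fin n)))] g' by
    obtain ⟨g', hbot', hconv', hae⟩ := h
    refine ⟨g', hbot', fun x y α hα => ?_, hae⟩
    rcases hα.1.eq_or_lt with rfl | h0
    · simp
    rcases hα.2.eq_or_lt with rfl | h1
    · simp
    exact EReal.le_combo_of_forall_lt (hbot' x) (hbot' y) h0 h1 (hconv' x y α h0 h1)
  by_cases htop : ∀ᵐ x, g x = ⊤
  · exact ⟨fun _ => ⊤, by simp, fun _ _ _ _ _ _ _ h => absurd h not_top_lt, htop⟩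
  have hae := ae_eq_approxLimsup volume hg
  have hcombo : ∀ x y : EuclideanSpace ℝ (Fin n), ∀ α : ℝ, 0 < α → α < 1 → ∀ s t : ℝ,
      approxLimsup volume g x < s → approxLimsup volume g y < t →
      approxLimsup volume g (α • x + (1 - α) • y) ≤ ((α * s + (1 - α) * t : ℝ) : EReal) :=
    fun x y α h0 h1 s t hs ht =>
      approxLimsup_combo_le hbot h0 h1 (hconv x y α ⟨h0.le, h1.le⟩) hs ht
  refine ⟨approxLimsup volume g, ne_bot_of_midpoint_le (μ := volume) ?_ (fun h => htop ?_)
    (fun x y => hcombo x y (1 / 2) (by norm_num) (by norm_num)), hcombo, hae⟩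
  · filter_upwards [hae] with x hx
    exact hx ▸ hbot x
  · filter_upwards [hae, h] with x hx hx'
    exact hx.trans hx'
end

section
/- Let n ≥ 1 be an integer and let L : ℝⁿ → [0,∞) be a Borel function with ∫ L dμ = 1 and ∫ L·log L dμ < ∞ (convention 0·log 0 = 0). Let ν be the probability measure with density L with respect to μ. Then there exists a probability measure γ on ℝⁿ × ℝⁿ whose first marginal (pushforward under (x,y) ↦ x) is μ and whose second marginal (pushforward under (x,y) ↦ y) is ν, such that ∫_{ℝⁿ×ℝⁿ} ‖x − y‖² dγ(x,y) ≤ 2 ∫_{ℝⁿ} L·log L dμ. (Talagrand's transportation inequality.) -/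
open MeasureTheory

section TransportEntropy

open ProbabilityTheory InformationTheory Set Filter Topology
open scoped ENNReal NNReal

lemma continuous_cdf (ν : Measure ℝ) [IsProbabilityMeasure ν] [NullSingletonClass ν] :
    Continuous (cdf ν) := by
  rw [continuous_iff_continuousAt]
  intro x
  rw [(monotone_cdf ν).continuousAt_iff_leftLim_eq_rightLim, (cdf ν).rightLim_eq]
  have h : (cdf ν).measure {x} = 0 := by rw [measure_cdf]; simp
  rw [StieltjesFunction.measure_singleton, ENNReal.ofReal_eq_zero] at h
  exact le_antisymm ((monotone_cdf ν).leftLim_le le_rfl) (by linarith)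

lemma exists_cdf_sublevel_eq_Iic (ν : Measure ℝ) [IsProbabilityMeasure ν] [NullSingletonClass ν]
    {u : ℝ} (hu0 : 0 < u) (hu1 : u < 1) :
    ∃ y₀, cdf ν y₀ = u ∧ {y | cdf ν y ≤ u} = Iic y₀ := by
  obtain ⟨a, ha⟩ := ((tendsto_cdf_atBot ν).eventually (gt_mem_nhds hu0)).exists
  obtain ⟨b, hb⟩ := ((tendsto_cdf_atTop ν).eventually (lt_mem_nhds hu1)).exists
  have hbdd : BddAbove {y | cdf ν y ≤ u} := by
    refine ⟨b, fun y hy => ?_⟩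
    by_contra! hlt
    exact absurd (hb.trans_le (monotone_cdf ν hlt.le)) (not_lt.2 hy)
  have hne : {y | cdf ν y ≤ u}.Nonempty := ⟨a, ha.le⟩
  have hmem := (isClosed_le (continuous_cdf ν) continuous_const).csSup_mem hne hbdd
  refine ⟨sSup {y | cdf ν y ≤ u}, le_antisymm hmem ?_, ?_⟩
  · refine ge_of_tendsto (((continuous_cdf ν).tendsto _).mono_left
      (nhdsWithin_le_nhds (s := Ioi (sSup {y | cdf ν y ≤ u})))) ?_
    filter_upwards [self_mem_nhdsWithin] with y hy
    by_contra! hlt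
    exact absurd (le_csSup hbdd hlt.le) (not_le.2 hy)
  · ext y
    exact ⟨fun hy => le_csSup hbdd hy, fun hy => (monotone_cdf ν hy).trans hmem⟩

/-- The probability integral transform. -/
lemma measure_cdf_le (ν : Measure ℝ) [IsProbabilityMeasure ν] [NullSingletonClass ν]
    {u : ℝ} (hu0 : 0 < u) (hu1 : u < 1) :
    ν {y | cdf ν y ≤ u} = ENNReal.ofReal u := by
  obtain ⟨y₀, h1, h2⟩ := exists_cdf_sublevel_eq_Iic ν hu0 hu1
  rw [h2, ← ofReal_cdf, h1]

lemma ae_cdf_pos (ν : Measure ℝ) [IsProbabilityMeasure ν] [NullSingletonClass ν] :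
    ∀ᵐ y ∂ν, 0 < cdf ν y := by
  rw [ae_iff]
  refine le_antisymm (ENNReal.le_of_forall_pos_le_add fun ε hε _ => ?_) zero_le
  have hm : (0 : ℝ) < min (ε : ℝ) (1 / 2) := lt_min (by exact_mod_cast hε) (by norm_num)
  calc ν {y | ¬ 0 < cdf ν y} ≤ ν {y | cdf ν y ≤ min (ε : ℝ) (1 / 2)} :=
        measure_mono fun y hy => (not_lt.1 hy).trans hm.le
    _ = ENNReal.ofReal (min (ε : ℝ) (1 / 2)) :=
        measure_cdf_le ν hm ((min_le_right _ _).trans_lt (by norm_num))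
    _ ≤ ENNReal.ofReal ε := ENNReal.ofReal_le_ofReal (min_le_left _ _)
    _ = 0 + ε := by simp

lemma ae_cdf_lt_one (ν : Measure ℝ) [IsProbabilityMeasure ν] [NullSingletonClass ν] :
    ∀ᵐ y ∂ν, cdf ν y < 1 := by
  rw [ae_iff]
  refine le_antisymm (ENNReal.le_of_forall_pos_le_add fun ε hε _ => ?_) zero_le
  have hm : (0 : ℝ) < min (ε : ℝ) (1 / 2) := lt_min (by exact_mod_cast hε) (by norm_num)
  have hm' : min (ε : ℝ) (1 / 2) ≤ 1 / 2 := min_le_right _ _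
  have hmeas : MeasurableSet {y | cdf ν y ≤ 1 - min (ε : ℝ) (1 / 2)} :=
    measurableSet_le (monotone_cdf ν).measurable measurable_const
  calc ν {y | ¬ cdf ν y < 1} ≤ ν {y | cdf ν y ≤ 1 - min (ε : ℝ) (1 / 2)}ᶜ := by
        refine measure_mono fun y hy => ?_
        simp only [mem_ofPred_eq, not_lt, mem_compl_iff, not_le] at hy ⊢
        linarith
    _ = 1 - ENNReal.ofReal (1 - min (ε : ℝ) (1 / 2)) := by
        rw [prob_compl_eq_one_sub hmeas, measure_cdf_le ν (by linarith) (by linarith)]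
    _ = ENNReal.ofReal (min (ε : ℝ) (1 / 2)) := by
        rw [← ENNReal.ofReal_one, ← ENNReal.ofReal_sub _ (by linarith)]
        congr 1; ring
    _ ≤ ENNReal.ofReal ε := ENNReal.ofReal_le_ofReal (min_le_left _ _)
    _ = 0 + ε := by simp

lemma strictMono_cdf_gaussianReal : StrictMono (cdf (gaussianReal 0 1)) := by
  intro a b hab
  have hpos : 0 < (gaussianReal 0 1) (Ioc a b) := by
    have := (gaussianReal_absolutelyContinuous' 0 (v := 1) one_ne_zero)
    rw [pos_iff_ne_zero]
    intro h
    have := this h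
    simp [hab.not_ge] at this
  rw [cdf_eq_real, cdf_eq_real, ← Iic_union_Ioc_eq_Iic hab.le,
    measureReal_union (by simp) measurableSet_Ioc]
  have : 0 < (gaussianReal 0 1).real (Ioc a b) := ENNReal.toReal_pos hpos.ne' (by finiteness)
  linarith

lemma cdf_gaussianReal_mem_Ioo (x : ℝ) : cdf (gaussianReal 0 1) x ∈ Ioo (0 : ℝ) 1 :=
  ⟨(cdf_nonneg _ (x - 1)).trans_lt (strictMono_cdf_gaussianReal (by linarith)),
    (strictMono_cdf_gaussianReal (lt_add_one x)).trans_le (cdf_le_one _ _)⟩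

instance : NullSingletonClass (gaussianReal 0 1) := nullSingletonClass_gaussianReal one_ne_zero

lemma measurableEmbedding_cdf_gaussianReal : MeasurableEmbedding (cdf (gaussianReal 0 1)) :=
  (continuous_cdf _).measurableEmbedding strictMono_cdf_gaussianReal.injective

/-- The quantile function of the standard Gaussian law, with junk values outside `(0, 1)`. -/
noncomputable def gaussianQuantile : ℝ → ℝ := measurableEmbedding_cdf_gaussianReal.invFun

lemma measurable_gaussianQuantile : Measurable gaussianQuantile :=
  measurableEmbedding_cdf_gaussianReal.measurable_invFun

lemma cdf_gaussianQuantile {u : ℝ} (hu0 : 0 < u) (hu1 : u < 1) :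
    cdf (gaussianReal 0 1) (gaussianQuantile u) = u := by
  obtain ⟨y, rfl, -⟩ := exists_cdf_sublevel_eq_Iic (gaussianReal 0 1) hu0 hu1
  rw [gaussianQuantile, measurableEmbedding_cdf_gaussianReal.leftInverse_invFun y]

lemma gaussianQuantile_le_iff {u s : ℝ} (hu0 : 0 < u) (hu1 : u < 1) :
    gaussianQuantile u ≤ s ↔ u ≤ cdf (gaussianReal 0 1) s := by
  rw [← strictMono_cdf_gaussianReal.le_iff_le, cdf_gaussianQuantile hu0 hu1]

/-- The monotone map which transports an atomless law `ν` to the standard Gaussian law. -/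
noncomputable def toGaussian (ν : Measure ℝ) (y : ℝ) : ℝ := gaussianQuantile (cdf ν y)

lemma measurable_toGaussian (ν : Measure ℝ) : Measurable (toGaussian ν) :=
  measurable_gaussianQuantile.comp (monotone_cdf ν).measurable

lemma map_toGaussian (ν : Measure ℝ) [IsProbabilityMeasure ν] [NullSingletonClass ν] :
    ν.map (toGaussian ν) = gaussianReal 0 1 := by
  have := Measure.isProbabilityMeasure_map (μ := ν) (measurable_toGaussian ν).aemeasurable
  refine Measure.ext_of_Iic _ _ fun s => ?_
  rw [Measure.map_apply (measurable_toGaussian ν) measurableSet_Iic,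
    ← ofReal_cdf (gaussianReal 0 1),
    ← measure_cdf_le ν (cdf_gaussianReal_mem_Ioo s).1 (cdf_gaussianReal_mem_Ioo s).2]
  refine measure_congr ?_
  filter_upwards [ae_cdf_pos ν, ae_cdf_lt_one ν] with y h0 h1
  exact propext (gaussianQuantile_le_iff h0 h1)

lemma setIntegral_Ioi_id_gaussianReal (s : ℝ) :
    ∫ x in Ioi s, x ∂gaussianReal 0 1 = gaussianPDFReal 0 1 s := by
  have hd : ∀ x ∈ Ici s, HasDerivAt (fun x => - gaussianPDFReal 0 1 x)
      (x * gaussianPDFReal 0 1 x) x := by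
    intro x _
    unfold gaussianPDFReal
    have : HasDerivAt (fun x : ℝ => -(x - 0) ^ 2 / (2 * ((1 : ℝ≥0) : ℝ))) (-x) x := by
      have := (((hasDerivAt_id x).sub_const 0).pow 2).neg.div_const (2 * ((1 : ℝ≥0) : ℝ))
      convert! this using 1
      simp
      ring
    convert! (this.exp.const_mul (√(2 * Real.pi * ((1 : ℝ≥0) : ℝ)))⁻¹).neg using 1
    ring
  have h_int : Integrable (fun x : ℝ => x) (gaussianReal 0 1) :=
    (memLp_id_gaussianReal 1).integrable (by norm_num)
  rw [gaussianReal_of_var_ne_zero _ one_ne_zero] at h_int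
  rw [integrable_withDensity_iff (measurable_gaussianPDF 0 1)
    (ae_of_all _ fun _ => gaussianPDF_lt_top)] at h_int
  simp only [toReal_gaussianPDF] at h_int
  rw [gaussianReal_of_var_ne_zero _ one_ne_zero,
    setIntegral_withDensity_eq_setIntegral_toReal_smul (measurable_gaussianPDF 0 1)
    (ae_of_all _ fun _ => gaussianPDF_lt_top) _ measurableSet_Ioi]
  simp only [toReal_gaussianPDF, smul_eq_mul, mul_comm (gaussianPDFReal 0 1 _)]
  have hlim : Tendsto (fun x => - gaussianPDFReal 0 1 x) atTop (𝓝 (-0)) := by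
    refine Tendsto.neg ?_
    have hexp : Tendsto (fun x : ℝ => Real.exp (-(x - 0) ^ 2 / (2 * ((1 : ℝ≥0) : ℝ))))
        atTop (𝓝 0) := by
      refine Real.tendsto_exp_atBot.comp ?_
      simp only [sub_zero, NNReal.coe_one, mul_one, neg_div]
      exact tendsto_neg_atTop_atBot.comp ((tendsto_pow_atTop two_ne_zero).atTop_div_const two_pos)
    simpa [gaussianPDFReal_def] using hexp.const_mul (√(2 * Real.pi * ((1 : ℝ≥0) : ℝ)))⁻¹
  rw [integral_Ioi_of_hasDerivAt_of_tendsto' hd h_int.integrableOn hlim]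
  ring

lemma memLp_toGaussian (ν : Measure ℝ) [IsProbabilityMeasure ν] [NullSingletonClass ν] :
    MemLp (toGaussian ν) 2 ν := by
  have h := memLp_id_gaussianReal (μ := 0) (v := 1) 2
  rw [← map_toGaussian ν] at h
  exact (memLp_map_measure_iff aestronglyMeasurable_id
    (measurable_toGaussian ν).aemeasurable).1 h

lemma integral_toGaussian (ν : Measure ℝ) [IsProbabilityMeasure ν] [NullSingletonClass ν] :
    ∫ y, toGaussian ν y ∂ν = 0 := by
  have h := integral_id_gaussianReal (μ := 0) (v := 1)
  rwa [← map_toGaussian ν, integral_map (measurable_toGaussian ν).aemeasurable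
    (by fun_prop)] at h

lemma integral_toGaussian_sq (ν : Measure ℝ) [IsProbabilityMeasure ν] [NullSingletonClass ν] :
    ∫ y, toGaussian ν y ^ 2 ∂ν = 1 := by
  have h := variance_fun_id_gaussianReal (μ := 0) (v := 1)
  rw [variance_eq_integral (by fun_prop), integral_id_gaussianReal, ← map_toGaussian ν,
    integral_map (measurable_toGaussian ν).aemeasurable (by fun_prop)] at h
  simpa using h

lemma setIntegral_Ioi_toGaussian (ν : Measure ℝ) [IsProbabilityMeasure ν] [NullSingletonClass ν]
    {y : ℝ}
    (h0 : 0 < cdf ν y) (h1 : cdf ν y < 1) :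
    ∫ z in Ioi y, toGaussian ν z ∂ν = gaussianPDFReal 0 1 (toGaussian ν y) := by
  rw [← setIntegral_Ioi_id_gaussianReal, ← map_toGaussian ν,
    setIntegral_map measurableSet_Ioi (by fun_prop)
    (measurable_toGaussian ν).aemeasurable]
  refine setIntegral_congr_set ?_
  have hsub : Iic y ⊆ {z | cdf ν z ≤ cdf ν y} := fun z hz => monotone_cdf ν hz
  have hae : (Iic y : Set ℝ) =ᵐ[ν] {z | cdf ν z ≤ cdf ν y} :=
    ae_eq_of_subset_of_measure_ge hsub (by rw [measure_cdf_le ν h0 h1, ofReal_cdf])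
      measurableSet_Iic.nullMeasurableSet (by finiteness)
  rw [← compl_Iic]
  refine hae.compl.trans ?_
  filter_upwards [ae_cdf_pos ν, ae_cdf_lt_one ν] with z hz0 hz1
  have := gaussianQuantile_le_iff (s := toGaussian ν y) hz0 hz1
  rw [toGaussian, cdf_gaussianQuantile h0 h1] at this
  refine propext ?_
  change ¬ (cdf ν z ≤ cdf ν y) ↔ toGaussian ν y < toGaussian ν z
  rw [← this, not_le]; rfl

lemma setIntegral_Ioi_toGaussian_nonneg (ν : Measure ℝ) [IsProbabilityMeasure ν]
    [NullSingletonClass ν]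
    (y : ℝ) : 0 ≤ ∫ z in Ioi y, toGaussian ν z ∂ν := by
  rcases (cdf_nonneg ν y).eq_or_lt with h0 | h0
  · have : ν (Iic y) = 0 := by rw [← ofReal_cdf, ← h0, ENNReal.ofReal_zero]
    have h : (Ioi y : Set ℝ) =ᵐ[ν] univ := by
      rw [← compl_Iic]; exact (ae_eq_univ.2 (by simpa using this))
    rw [setIntegral_congr_set h, setIntegral_univ, integral_toGaussian]
  rcases (cdf_le_one ν y).eq_or_lt with h1 | h1
  · have : ν (Ioi y) = 0 := by
      rw [← compl_Iic, prob_compl_eq_zero_iff measurableSet_Iic, ← ofReal_cdf, h1,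
        ENNReal.ofReal_one]
    rw [setIntegral_measure_zero _ this]
  · rw [setIntegral_Ioi_toGaussian ν h0 h1]
    exact gaussianPDFReal_nonneg _ _ _

lemma integrable_integral_setIntegral_Ioi_toGaussian (ν : Measure ℝ) [IsProbabilityMeasure ν]
    [NullSingletonClass ν] (hν : MemLp id 2 ν) :
    Integrable (fun t => ∫ z in Ioi t, toGaussian ν z ∂ν) ∧
      ∫ t, ∫ z in Ioi t, toGaussian ν z ∂ν = ∫ y, toGaussian ν y * y ∂ν := by
  have hS : Integrable (toGaussian ν) ν := (memLp_toGaussian ν).integrable (by norm_num)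
  have hSy : Integrable (fun y => toGaussian ν y * y) ν := (memLp_toGaussian ν).integrable_mul hν
  let w : ℝ → ℝ → ℝ := fun y t => (Ico 0 y).indicator 1 t - (Ico y 0).indicator 1 t
  have hind (a b : ℝ) : Integrable ((Ico a b).indicator (1 : ℝ → ℝ)) volume :=
    (integrable_indicator_iff measurableSet_Ico).2 (integrableOn_const (by simp))
  have hw (y : ℝ) : Integrable (w y) volume := (hind _ _).sub (hind _ _)
  have hw_int (y : ℝ) : ∫ t, w y t = y := by
    simp only [w]
    rw [integral_sub (hind _ _) (hind _ _), integral_indicator_one measurableSet_Ico,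
      integral_indicator_one measurableSet_Ico, Real.volume_real_Ico, Real.volume_real_Ico]
    rcases le_total 0 y with h | h <;> simp [h]
  have hw_norm (y : ℝ) : ∫ t, ‖w y t‖ = |y| := by
    have : ∀ t, ‖w y t‖ = (Ico 0 y).indicator 1 t + (Ico y 0).indicator 1 t := by
      intro t
      simp only [w, indicator, mem_Ico, Pi.one_apply]
      split_ifs <;> first | (exfalso; linarith) | simp
    simp only [this]
    rw [integral_add (hind _ _) (hind _ _), integral_indicator_one measurableSet_Ico,
      integral_indicator_one measurableSet_Ico, Real.volume_real_Ico, Real.volume_real_Ico]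
    rcases le_total 0 y with h | h <;> simp [h, abs_of_nonneg, abs_of_nonpos]
  have hw_eq (y t : ℝ) : w y t = (Ioi t).indicator 1 y - (Iio 0).indicator 1 t := by
    simp only [w, indicator, mem_Ico, Pi.one_apply, mem_Ioi, mem_Iio]
    split_ifs <;> grind
  have hw_meas : Measurable (fun p : ℝ × ℝ => w p.1 p.2) := by
    simp only [hw_eq]
    refine Measurable.sub ?_ ((measurable_one.indicator measurableSet_Iio).comp measurable_snd)
    exact measurable_one.indicator (measurableSet_lt measurable_snd measurable_fst)
  have hG : Integrable (fun p : ℝ × ℝ => toGaussian ν p.1 * w p.1 p.2) (ν.prod volume) := by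
    have hmeas : Measurable (fun p : ℝ × ℝ => toGaussian ν p.1 * w p.1 p.2) :=
      ((measurable_toGaussian ν).comp measurable_fst).mul hw_meas
    rw [integrable_prod_iff hmeas.aestronglyMeasurable]
    refine ⟨ae_of_all _ fun y => (hw y).const_mul (toGaussian ν y), ?_⟩
    simp only [norm_mul, integral_const_mul, hw_norm]
    simpa using hSy.norm
  have hk (t : ℝ) : ∫ y, toGaussian ν y * w y t ∂ν = ∫ z in Ioi t, toGaussian ν z ∂ν := by
    have h1 (y : ℝ) : toGaussian ν y * w y t
        = (Ioi t).indicator (toGaussian ν) y - toGaussian ν y * (Iio 0).indicator 1 t := by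
      rw [hw_eq, mul_sub]
      congr 1
      simp [indicator]
    simp only [h1]
    rw [integral_sub (hS.indicator measurableSet_Ioi) (hS.mul_const _), integral_mul_const,
      integral_toGaussian, zero_mul, sub_zero, integral_indicator measurableSet_Ioi]
  constructor
  · simpa only [hk] using hG.integral_prod_right
  · have h := integral_integral_swap (f := fun y t => toGaussian ν y * w y t) hG
    simp only [integral_const_mul, hw_int, hk] at h
    exact h.symm

lemma integrable_div_rnDeriv {α : Type*} {mα : MeasurableSpace α} {μ ν : Measure α}
    [SigmaFinite μ] [SigmaFinite ν] (hνμ : ν ≪ μ) {h : α → ℝ} (h0 : ∀ x, 0 ≤ h x)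
    (hi : Integrable h μ) :
    Integrable (fun x => h x / (ν.rnDeriv μ x).toReal) ν ∧
      ∫ x, h x / (ν.rnDeriv μ x).toReal ∂ν ≤ ∫ x, h x ∂μ := by
  have hmeas : AEMeasurable (fun x => h x / (ν.rnDeriv μ x).toReal) μ :=
    hi.aemeasurable.div (Measure.measurable_rnDeriv _ _).ennreal_toReal.aemeasurable
  have hmeas' := (hmeas.mono_ac hνμ).aestronglyMeasurable
  have hnn (x) : 0 ≤ h x / (ν.rnDeriv μ x).toReal := div_nonneg (h0 x) ENNReal.toReal_nonneg
  have hle : ∫⁻ x, ENNReal.ofReal (h x / (ν.rnDeriv μ x).toReal) ∂ν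
      ≤ ∫⁻ x, ENNReal.ofReal (h x) ∂μ := by
    rw [← lintegral_rnDeriv_mul hνμ hmeas.ennreal_ofReal]
    refine lintegral_mono_ae ?_
    filter_upwards [Measure.rnDeriv_ne_top ν μ] with x hx
    rw [← ENNReal.ofReal_toReal hx, ← ENNReal.ofReal_mul ENNReal.toReal_nonneg,
      ENNReal.toReal_ofReal ENNReal.toReal_nonneg]
    refine ENNReal.ofReal_le_ofReal ?_
    rcases eq_or_ne (ν.rnDeriv μ x).toReal 0 with h' | h'
    · simp [h', h0 x]
    · rw [mul_div_cancel₀ _ h']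
  have hfin : ∫⁻ x, ENNReal.ofReal (h x) ∂μ ≠ ∞ := hi.lintegral_lt_top.ne
  refine ⟨⟨hmeas', ?_⟩, ?_⟩
  · rw [hasFiniteIntegral_iff_ofReal (ae_of_all _ hnn)]
    exact hle.trans_lt hfin.lt_top
  · rw [integral_eq_lintegral_of_nonneg_ae (ae_of_all _ hnn) hmeas',
      integral_eq_lintegral_of_nonneg_ae (ae_of_all _ h0) hi.aestronglyMeasurable]
    exact ENNReal.toReal_mono hfin hle

lemma integrable_gaussianReal_iff {f : ℝ → ℝ} :
    Integrable f (gaussianReal 0 1) ↔ Integrable (fun x => f x * gaussianPDFReal 0 1 x) := by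
  rw [gaussianReal_of_var_ne_zero _ one_ne_zero,
    integrable_withDensity_iff (measurable_gaussianPDF 0 1)
      (ae_of_all _ fun _ => gaussianPDF_lt_top)]
  simp only [toReal_gaussianPDF]

lemma memLp_id_of_integrable_llr_gaussianReal {ν : Measure ℝ} [IsProbabilityMeasure ν]
    (hac : ν ≪ gaussianReal 0 1) (h_int : Integrable (llr ν (gaussianReal 0 1)) ν) :
    MemLp id 2 ν := by
  have hexp : Integrable (fun y : ℝ => Real.exp (y ^ 2 / 4)) (gaussianReal 0 1) := by
    rw [integrable_gaussianReal_iff]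
    refine ((integrable_exp_neg_mul_sq (b := 1 / 4) (by norm_num)).const_mul
      (√(2 * Real.pi))⁻¹).congr (ae_of_all _ fun y => ?_)
    simp only [gaussianPDFReal, sub_zero, NNReal.coe_one, mul_one]
    rw [mul_left_comm, ← Real.exp_add]
    ring_nf
  have h := (integrable_div_rnDeriv hac (fun _ => (Real.exp_pos _).le) hexp).1
  rw [memLp_two_iff_integrable_sq aestronglyMeasurable_id]
  refine (((h_int.add h).const_mul 4).mono' (by fun_prop) ?_)
  filter_upwards [Measure.rnDeriv_pos hac, hac.ae_le (Measure.rnDeriv_ne_top ν _)] with y h0 h1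
  have hl : 0 < (ν.rnDeriv (gaussianReal 0 1) y).toReal := ENNReal.toReal_pos h0.ne' h1
  have := Real.log_le_sub_one_of_pos (div_pos (Real.exp_pos (y ^ 2 / 4)) hl)
  rw [Real.log_div (Real.exp_pos _).ne' hl.ne', Real.log_exp] at this
  simp only [Pi.add_apply, llr, id, norm_pow, Real.norm_eq_abs, sq_abs]
  linarith

/-- Talagrand's inequality on the line. -/
theorem lintegral_toGaussian_sub_sq_le {ν : Measure ℝ} [IsProbabilityMeasure ν] :
    ∫⁻ y, ENNReal.ofReal ((toGaussian ν y - y) ^ 2) ∂ν ≤ 2 * klDiv ν (gaussianReal 0 1) := by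
  by_cases htop : klDiv ν (gaussianReal 0 1) = ∞
  · simp [htop]
  obtain ⟨hac, h_int⟩ := klDiv_ne_top_iff.1 htop
  have : NullSingletonClass ν := ⟨fun x => hac (measure_singleton x)⟩
  have hy := memLp_id_of_integrable_llr_gaussianReal hac h_int
  have hS := memLp_toGaussian ν
  obtain ⟨hk_int, hk_eq⟩ := integrable_integral_setIntegral_Ioi_toGaussian ν hy
  set k : ℝ → ℝ := fun t => ∫ z in Ioi t, toGaussian ν z ∂ν with hk
  have hk0 (t : ℝ) : 0 ≤ k t := setIntegral_Ioi_toGaussian_nonneg ν t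
  have hφ (t : ℝ) : 0 < gaussianPDFReal 0 1 t := gaussianPDFReal_pos _ _ _ one_ne_zero
  have hh_mul (t : ℝ) : k t / gaussianPDFReal 0 1 t * gaussianPDFReal 0 1 t = k t :=
    div_mul_cancel₀ _ (hφ t).ne'
  have hh : Integrable (fun t => k t / gaussianPDFReal 0 1 t) (gaussianReal 0 1) := by
    rw [integrable_gaussianReal_iff]
    simpa only [hh_mul] using hk_int
  obtain ⟨hd_int, hd_le⟩ := integrable_div_rnDeriv hac
    (fun t => div_nonneg (hk0 t) (hφ t).le) hh
  have hh_eq : ∫ t, k t / gaussianPDFReal 0 1 t ∂gaussianReal 0 1 = ∫ y, toGaussian ν y * y ∂ν := by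
    rw [integral_gaussianReal_eq_integral_smul one_ne_zero, ← hk_eq]
    simp only [smul_eq_mul, mul_comm (gaussianPDFReal 0 1 _), hh_mul]
  rw [hh_eq] at hd_le
  have hS2 : Integrable (fun y => toGaussian ν y ^ 2) ν := hS.integrable_sq
  have hy2 : Integrable (fun y : ℝ => y ^ 2) ν := hy.integrable_sq
  have hSy : Integrable (fun y => toGaussian ν y * y) ν := hS.integrable_mul hy
  have hmain : ∫ y, (y ^ 2 / 2 - toGaussian ν y ^ 2 / 2 - llr ν (gaussianReal 0 1) y) ∂ν
      ≤ ∫ y, (k y / gaussianPDFReal 0 1 y / (ν.rnDeriv (gaussianReal 0 1) y).toReal - 1) ∂ν := by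
    refine integral_mono_ae (((hy2.div_const 2).sub (hS2.div_const 2)).sub h_int)
      (hd_int.sub (integrable_const 1)) ?_
    filter_upwards [Measure.rnDeriv_pos hac, hac.ae_le (Measure.rnDeriv_ne_top ν _),
      ae_cdf_pos ν, ae_cdf_lt_one ν] with y h0 h1 h2 h3
    have hl : 0 < (ν.rnDeriv (gaussianReal 0 1) y).toReal := ENNReal.toReal_pos h0.ne' h1
    have hky : k y = gaussianPDFReal 0 1 (toGaussian ν y) := setIntegral_Ioi_toGaussian ν h2 h3
    have hq : k y / gaussianPDFReal 0 1 y = Real.exp (y ^ 2 / 2 - toGaussian ν y ^ 2 / 2) := by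
      rw [hky, gaussianPDFReal, gaussianPDFReal, mul_div_mul_left _ _ (by positivity),
        ← Real.exp_sub]
      congr 1
      simp
      ring
    have := Real.log_le_sub_one_of_pos
      (div_pos (Real.exp_pos (y ^ 2 / 2 - toGaussian ν y ^ 2 / 2)) hl)
    rw [Real.log_div (Real.exp_pos _).ne' hl.ne', Real.log_exp] at this
    simp only [hq, llr]
    exact this
  rw [integral_sub (f := fun y => y ^ 2 / 2 - toGaussian ν y ^ 2 / 2)
      ((hy2.div_const 2).sub (hS2.div_const 2)) h_int,
    integral_sub (hy2.div_const 2) (hS2.div_const 2), integral_div, integral_div,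
    integral_toGaussian_sq, integral_sub hd_int (integrable_const 1)] at hmain
  simp only [integral_const, probReal_univ, smul_eq_mul, mul_one] at hmain
  have hcost_int : Integrable (fun y => (toGaussian ν y - y) ^ 2) ν := (hS.sub hy).integrable_sq
  have hcost : ∫ y, (toGaussian ν y - y) ^ 2 ∂ν
      = 1 - 2 * ∫ y, toGaussian ν y * y ∂ν + ∫ y, y ^ 2 ∂ν := by
    have (y : ℝ) : (toGaussian ν y - y) ^ 2
        = toGaussian ν y ^ 2 - 2 * (toGaussian ν y * y) + y ^ 2 := by ring
    simp only [this]
    rw [integral_add (f := fun y => toGaussian ν y ^ 2 - 2 * (toGaussian ν y * y))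
        (hS2.sub (hSy.const_mul 2)) hy2, integral_sub hS2 (hSy.const_mul 2),
      integral_const_mul, integral_toGaussian_sq]
  rw [← ofReal_integral_eq_lintegral_ofReal hcost_int (ae_of_all _ fun _ => sq_nonneg _), hcost,
    klDiv_of_ac_of_integrable hac h_int, ← ENNReal.ofReal_ofNat 2, ← ENNReal.ofReal_mul (by simp)]
  refine ENNReal.ofReal_le_ofReal ?_
  simp only [probReal_univ]
  linarith

lemma klDiv_compProd_right_eq_lintegral {E F : Type*} [MeasurableSpace E] [MeasurableSpace F]
    [MeasurableSpace.CountableOrCountablyGenerated E F] {α : Measure E} [IsFiniteMeasure α]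
    {κ η : Kernel E F} [IsFiniteKernel κ] [IsFiniteKernel η] (h : α ⊗ₘ κ ≪ α ⊗ₘ η) :
    klDiv (α ⊗ₘ κ) (α ⊗ₘ η) = ∫⁻ x, klDiv (κ x) (η x) ∂α := by
  have hac : ∀ᵐ a ∂α, κ a ≪ η a := h.kernel_of_compProd
  have hdens : α ⊗ₘ κ = (α ⊗ₘ η).withDensity fun p => κ.rnDeriv η p.1 p.2 := by
    have hκ : ∀ᵐ a ∂α, κ a = η.withDensity (κ.rnDeriv η) a := by
      filter_upwards [hac] with a ha using (Kernel.withDensity_rnDeriv_eq ha).symm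
    rw [Measure.compProd_congr hκ, Measure.compProd_withDensity (by fun_prop)]
  have hmeas : Measurable fun p : E × F => κ.rnDeriv η p.1 p.2 := by fun_prop
  have hrn := Measure.rnDeriv_withDensity (α ⊗ₘ η) hmeas
  rw [← hdens] at hrn
  rw [klDiv_eq_lintegral_klFun_of_ac h]
  calc ∫⁻ p, ENNReal.ofReal (klFun ((α ⊗ₘ κ).rnDeriv (α ⊗ₘ η) p).toReal) ∂(α ⊗ₘ η)
      = ∫⁻ p, ENNReal.ofReal (klFun (κ.rnDeriv η p.1 p.2).toReal) ∂(α ⊗ₘ η) := by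
        refine lintegral_congr_ae ?_
        filter_upwards [hrn] with p hp
        rw [hp]
    _ = ∫⁻ x, ∫⁻ y, ENNReal.ofReal (klFun (κ.rnDeriv η x y).toReal) ∂η x ∂α := by
        rw [Measure.lintegral_compProd]
        exact (measurable_klFun.comp hmeas.ennreal_toReal).ennreal_ofReal
    _ = ∫⁻ x, klDiv (κ x) (η x) ∂α := by
        refine lintegral_congr_ae ?_
        filter_upwards [hac] with x hx
        rw [klDiv_eq_lintegral_klFun_of_ac hx]
        refine lintegral_congr_ae ?_
        filter_upwards [κ.rnDeriv_eq_rnDeriv_measure (η := η) (a := x)] with y hy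
        rw [hy]

/-- The transport-entropy inequality for the measure `μ` and the cost `c`: every probability measure
of finite relative entropy with respect to `μ` is coupled to `μ` at a cost bounded by twice the
relative entropy. -/
def TransportEntropy {E : Type*} [MeasurableSpace E] (c : E × E → ℝ≥0∞) (μ : Measure E) : Prop :=
  ∀ ν : Measure E, IsProbabilityMeasure ν → klDiv ν μ ≠ ∞ →
    ∃ γ : Measure (E × E), γ.map Prod.fst = μ ∧ γ.map Prod.snd = ν ∧
      ∫⁻ p, c p ∂γ ≤ 2 * klDiv ν μ

lemma measurable_toGaussian_kernel {E : Type*} [MeasurableSpace E] (κ : Kernel E ℝ)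
    [IsMarkovKernel κ] : Measurable fun p : E × ℝ => toGaussian (κ p.1) p.2 := by
  refine measurable_gaussianQuantile.comp ?_
  simp_rw [cdf_eq_real]
  have hs : MeasurableSet {q : (E × ℝ) × ℝ | q.2 ≤ q.1.2} :=
    measurableSet_le measurable_snd (measurable_snd.comp measurable_fst)
  exact (Kernel.measurable_kernel_prodMk_left (κ := κ.comap Prod.fst measurable_fst)
    hs).ennreal_toReal

lemma TransportEntropy.prod_gaussianReal {E : Type*} [MeasurableSpace E] {c : E × E → ℝ≥0∞}
    (hc : Measurable c) {μ : Measure E} [IsProbabilityMeasure μ] (h : TransportEntropy c μ) :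
    TransportEntropy (fun p => c (p.1.1, p.2.1) + ENNReal.ofReal ((p.1.2 - p.2.2) ^ 2))
      (μ.prod (gaussianReal 0 1)) := by
  intro ν hν hkl
  set α := ν.fst
  set κ := ν.condKernel
  have hdis : α ⊗ₘ κ = ν := ν.disintegrate κ
  have hprod : μ.prod (gaussianReal 0 1) = μ ⊗ₘ Kernel.const E (gaussianReal 0 1) :=
    Measure.compProd_const.symm
  have hac : α ⊗ₘ κ ≪ μ ⊗ₘ Kernel.const E (gaussianReal 0 1) := by
    rw [hdis, ← hprod]
    exact (klDiv_ne_top_iff.1 hkl).1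
  have hac' := (Measure.absolutelyContinuous_compProd_iff.1 hac).2
  have hfib : ∀ᵐ y ∂α, NullSingletonClass (κ y) := by
    filter_upwards [hac'.kernel_of_compProd] with y hy
    exact ⟨fun x => hy (by simp)⟩
  have hsum : klDiv ν (μ.prod (gaussianReal 0 1))
      = klDiv α μ + ∫⁻ y, klDiv (κ y) (gaussianReal 0 1) ∂α := by
    have := klDiv_compProd_eq_add α μ κ (Kernel.const E (gaussianReal 0 1))
    rw [hdis, ← hprod, ← hdis, klDiv_compProd_right_eq_lintegral hac', hdis] at this
    simpa using this
  have hklα : klDiv α μ ≠ ∞ := ne_top_of_le_ne_top hkl (hsum ▸ le_self_add)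
  obtain ⟨γ, hγ1, hγ2, hγc⟩ := h α inferInstance hklα
  have hγ : IsProbabilityMeasure γ := by
    have : IsProbabilityMeasure (γ.map Prod.fst) := hγ1 ▸ inferInstance
    exact Measure.isProbabilityMeasure_of_map Prod.fst
  have hS := measurable_toGaussian_kernel κ
  have hfibγ : ∀ᵐ p ∂γ, NullSingletonClass (κ p.2) :=
    ae_of_ae_map measurable_snd.aemeasurable (hγ2 ▸ hfib)
  set T : (E × E) × ℝ → (E × ℝ) × (E × ℝ) :=
    fun q => ((q.1.1, toGaussian (κ q.1.2) q.2), (q.1.2, q.2))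
  have hTm : Measurable T :=
    ((measurable_fst.comp measurable_fst).prodMk
      (hS.comp ((measurable_snd.comp measurable_fst).prodMk measurable_snd))).prodMk
      ((measurable_snd.comp measurable_fst).prodMk measurable_snd)
  have hlin : ∀ f : (E × ℝ) × (E × ℝ) → ℝ≥0∞, Measurable f →
      ∫⁻ q, f q ∂((γ ⊗ₘ κ.comap Prod.snd measurable_snd).map T)
        = ∫⁻ p, ∫⁻ t, f ((p.1, toGaussian (κ p.2) t), (p.2, t)) ∂κ p.2 ∂γ := by
    intro f hf
    rw [lintegral_map hf hTm]
    exact Measure.lintegral_compProd (hf.comp hTm)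
  refine ⟨(γ ⊗ₘ κ.comap Prod.snd measurable_snd).map T, ?_, ?_, ?_⟩
  · refine Measure.ext_of_lintegral _ fun f hf => ?_
    rw [lintegral_map hf measurable_fst, hlin (fun q => f q.1) (hf.comp measurable_fst),
      lintegral_prod _ hf.aemeasurable, ← hγ1,
      lintegral_map hf.lintegral_prod_right' measurable_fst]
    refine lintegral_congr_ae ?_
    filter_upwards [hfibγ] with p hp
    rw [← map_toGaussian (κ p.2),
      lintegral_map (f := fun s => f (p.1, s)) (hf.comp measurable_prodMk_left)
        (measurable_toGaussian _)]
  · refine Measure.ext_of_lintegral _ fun f hf => ?_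
    rw [lintegral_map hf measurable_snd, hlin (fun q => f q.2) (hf.comp measurable_snd), ← hdis,
      Measure.lintegral_compProd hf, ← hγ2, lintegral_map ?_ measurable_snd]
    exact hf.lintegral_kernel_prod_right'
  · have hsq : Measurable fun p : E × ℝ => ENNReal.ofReal ((toGaussian (κ p.1) p.2 - p.2) ^ 2) :=
      ((hS.sub measurable_snd).pow_const 2).ennreal_ofReal
    rw [hlin _ (by fun_prop), hsum, mul_add]
    calc ∫⁻ p, ∫⁻ t, c (p.1, p.2) + ENNReal.ofReal ((toGaussian (κ p.2) t - t) ^ 2) ∂κ p.2 ∂γ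
        = ∫⁻ p, c p ∂γ
          + ∫⁻ p, ∫⁻ t, ENNReal.ofReal ((toGaussian (κ p.2) t - t) ^ 2) ∂κ p.2 ∂γ := by
          rw [← lintegral_add_left hc]
          refine lintegral_congr fun p => ?_
          rw [lintegral_add_left measurable_const]
          simp
      _ = ∫⁻ p, c p ∂γ
          + ∫⁻ y, ∫⁻ t, ENNReal.ofReal ((toGaussian (κ y) t - t) ^ 2) ∂κ y ∂α := by
          rw [← hγ2, lintegral_map hsq.lintegral_kernel_prod_right' measurable_snd]
      _ ≤ _ := by
          refine add_le_add hγc ?_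
          rw [← lintegral_const_mul' _ _ (by norm_num)]
          exact lintegral_mono fun y => lintegral_toGaussian_sub_sq_le

lemma TransportEntropy.map {E F : Type*} [MeasurableSpace E] [MeasurableSpace F]
    {c : E × E → ℝ≥0∞} {μ : Measure E} [IsProbabilityMeasure μ] (h : TransportEntropy c μ)
    (e : E ≃ᵐ F) {c' : F × F → ℝ≥0∞} (hc' : Measurable c')
    (hcc' : ∀ x y, c' (e x, e y) = c (x, y)) :
    TransportEntropy c' (μ.map e) := by
  intro ν hν hkl
  have hle : klDiv (ν.map e.symm) μ ≤ klDiv ν (μ.map e) := by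
    have := klDiv_map_le (μ := ν) (ν := μ.map e) e.symm.measurable
    simpa using this
  obtain ⟨γ, hγ1, hγ2, hγc⟩ := h (ν.map e.symm)
    (Measure.isProbabilityMeasure_map e.symm.measurable.aemeasurable) (ne_top_of_le_ne_top hkl hle)
  have hm : Measurable (Prod.map e e) := e.measurable.prodMap e.measurable
  refine ⟨γ.map (Prod.map e e), ?_, ?_, ?_⟩
  · rw [Measure.map_map measurable_fst hm, ← hγ1, Measure.map_map e.measurable measurable_fst]
    rfl
  · rw [Measure.map_map measurable_snd hm]
    change γ.map (e ∘ Prod.snd) = ν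
    rw [← Measure.map_map e.measurable measurable_snd, hγ2]
    simp
  · rw [lintegral_map hc' hm]
    refine le_trans (le_of_eq (lintegral_congr fun p => hcc' p.1 p.2)) (hγc.trans ?_)
    gcongr

lemma transportEntropy_pi_gaussianReal (n : ℕ) :
    TransportEntropy
      (fun p : (Fin n → ℝ) × (Fin n → ℝ) => ∑ i, ENNReal.ofReal ((p.1 i - p.2 i) ^ 2))
      (Measure.pi fun _ : Fin n => gaussianReal 0 1) := by
  induction n with
  | zero =>
    intro ν hν _
    refine ⟨(Measure.pi fun _ : Fin 0 => gaussianReal 0 1).prod ν, ?_, ?_, by simp⟩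
    · rw [← Measure.fst, Measure.fst_prod]
    · rw [← Measure.snd, Measure.snd_prod]
  | succ n ih =>
    have hmp := measurePreserving_piFinSuccAbove (fun _ : Fin (n + 1) => gaussianReal 0 1) 0
    let e := MeasurableEquiv.prodComm.trans
      (MeasurableEquiv.piFinSuccAbove (fun _ : Fin (n + 1) => ℝ) 0).symm
    have hmap : ((Measure.pi fun _ : Fin n => gaussianReal 0 1).prod (gaussianReal 0 1)).map e
        = Measure.pi fun _ : Fin (n + 1) => gaussianReal 0 1 := by
      exact (hmp.symm.comp Measure.measurePreserving_swap).map_eq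
    rw [← hmap]
    refine (ih.prod_gaussianReal (Finset.measurable_fun_sum _ fun i _ => by fun_prop)).map e
      (Finset.measurable_fun_sum _ fun i _ => by fun_prop) fun x y => ?_
    rw [Fin.sum_univ_succ, add_comm]
    simp [e, MeasurableEquiv.piFinSuccAbove, MeasurableEquiv.prodComm]

lemma pi_gaussianReal_eq_withDensity {ι : Type*} [Fintype ι] :
    (Measure.pi fun _ : ι => gaussianReal 0 1)
      = volume.withDensity fun x => ENNReal.ofReal (∏ i, gaussianPDFReal 0 1 (x i)) := by
  refine Measure.pi_eq fun s hs => ?_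
  have h_int : ∀ i, Integrable (gaussianPDFReal 0 1) (volume.restrict (s i)) := fun i =>
    (integrable_gaussianPDFReal 0 1).restrict
  rw [withDensity_apply _ (MeasurableSet.univ_pi hs), volume_pi, Measure.restrict_pi_pi,
    ← ofReal_integral_eq_lintegral_ofReal (Integrable.fintype_prod h_int)
      (Eventually.of_forall fun x => Finset.prod_nonneg fun i _ => gaussianPDFReal_nonneg 0 1 _),
    integral_fintype_prod_eq_prod (fun _ => gaussianPDFReal 0 1),
    ENNReal.ofReal_prod_of_nonneg fun i _ => integral_nonneg (gaussianPDFReal_nonneg 0 1)]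
  exact Finset.prod_congr rfl fun i _ => (gaussianReal_apply_eq_integral 0 one_ne_zero (s i)).symm

lemma prod_gaussianPDFReal_eq {n : ℕ} (x : EuclideanSpace ℝ (Fin n)) :
    ∏ i, gaussianPDFReal 0 1 (x i)
      = (2 * Real.pi) ^ (-(n : ℝ) / 2) * Real.exp (-‖x‖ ^ 2 / 2) := by
  have hpi : 0 < 2 * Real.pi := by positivity
  simp only [gaussianPDFReal_def, NNReal.coe_one, mul_one, sub_zero]
  rw [Finset.prod_mul_distrib, ← Real.exp_sum, Finset.prod_const, Finset.card_univ,
    Fintype.card_fin, EuclideanSpace.real_norm_sq_eq, ← Finset.sum_div, Finset.sum_neg_distrib]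
  congr 1
  rw [Real.sqrt_eq_rpow, ← Real.rpow_neg hpi.le, ← Real.rpow_natCast, ← Real.rpow_mul hpi.le]
  congr 1
  ring

lemma map_toLp_pi_gaussianReal (n : ℕ) :
    (Measure.pi fun _ : Fin n => gaussianReal 0 1).map (MeasurableEquiv.toLp 2 (Fin n → ℝ))
      = _root_.stdGaussian n := by
  have hvol : volume.map (MeasurableEquiv.toLp 2 (Fin n → ℝ)) = volume :=
    (PiLp.volume_preserving_toLp (Fin n)).map_eq
  rw [pi_gaussianReal_eq_withDensity, _root_.stdGaussian, ← hvol]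
  ext s hs
  rw [MeasurableEquiv.map_apply,
    withDensity_apply _ ((MeasurableEquiv.toLp 2 (Fin n → ℝ)).measurable hs),
    withDensity_apply _ hs, (MeasurableEquiv.toLp 2 (Fin n → ℝ)).restrict_map,
    lintegral_map_equiv]
  refine lintegral_congr fun x => ?_
  rw [← prod_gaussianPDFReal_eq]
  rfl

lemma klDiv_withDensity_ofReal {E : Type*} [MeasurableSpace E] {μ : Measure E}
    [IsProbabilityMeasure μ] {L : E → ℝ} (hL : Measurable L) (hpos : ∀ x, 0 ≤ L x)
    [IsProbabilityMeasure (μ.withDensity fun x => ENNReal.ofReal (L x))]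
    (h_int : Integrable (fun x => L x * Real.log (L x)) μ) :
    klDiv (μ.withDensity fun x => ENNReal.ofReal (L x)) μ
      = ENNReal.ofReal (∫ x, L x * Real.log (L x) ∂μ) := by
  set ν := μ.withDensity fun x => ENNReal.ofReal (L x) with hν
  have hac : ν ≪ μ := withDensity_absolutelyContinuous _ _
  have hrn : ∀ᵐ x ∂μ, (ν.rnDeriv μ x).toReal = L x := by
    filter_upwards [Measure.rnDeriv_withDensity μ hL.ennreal_ofReal] with x hx
    rw [hx, ENNReal.toReal_ofReal (hpos x)]
  have hllr : (fun x => (ν.rnDeriv μ x).toReal * Real.log (ν.rnDeriv μ x).toReal)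
      =ᵐ[μ] fun x => L x * Real.log (L x) := by
    filter_upwards [hrn] with x hx
    rw [hx]
  have hi : Integrable (llr ν μ) ν :=
    (integrable_rnDeriv_mul_log_iff hac).1 (h_int.congr hllr.symm)
  rw [klDiv_of_ac_of_integrable hac hi, ← integral_congr_ae hllr]
  have := integral_rnDeriv_smul (f := llr ν μ) hac
  simp only [smul_eq_mul, llr] at this
  simp [llr, this]

end TransportEntropy

/-- Talagrand's transportation inequality: the quadratic transportation cost
between `μ` and `L·μ` is bounded by twice the relative entropy. -/
theorem talagrand_transport (n : ℕ) (hn : 1 ≤ n)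
    (L : EuclideanSpace ℝ (Fin n) → ℝ) (hLmeas : Measurable L)
    (hLpos : ∀ x, 0 ≤ L x)
    (hL1 : ∫ x, L x ∂stdGaussian n = 1)
    (hLlogL : Integrable (fun x => L x * Real.log (L x)) (stdGaussian n)) :
    ∃ γ : Measure (EuclideanSpace ℝ (Fin n) × EuclideanSpace ℝ (Fin n)),
      IsProbabilityMeasure γ ∧
      γ.map Prod.fst = stdGaussian n ∧
      γ.map Prod.snd
        = (stdGaussian n).withDensity (fun x => ENNReal.ofReal (L x)) ∧
      ∫⁻ p, ENNReal.ofReal (‖p.1 - p.2‖ ^ 2) ∂γ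
        ≤ ENNReal.ofReal (2 * ∫ x, L x * Real.log (L x) ∂stdGaussian n) := by
  have hμ : IsProbabilityMeasure (stdGaussian n) := by
    rw [← map_toLp_pi_gaussianReal]
    exact Measure.isProbabilityMeasure_map (MeasurableEquiv.measurable _).aemeasurable
  have hLint : Integrable L (stdGaussian n) := .of_integral_ne_zero (by simp [hL1])
  have hν : IsProbabilityMeasure ((stdGaussian n).withDensity fun x => ENNReal.ofReal (L x)) := by
    refine ⟨?_⟩
    rw [withDensity_apply _ .univ, setLIntegral_univ,
      ← ofReal_integral_eq_lintegral_ofReal hLint (.of_forall hLpos), hL1,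
      ENNReal.ofReal_one]
  have hkl := klDiv_withDensity_ofReal hLmeas hLpos hLlogL
  have hT : TransportEntropy
      (fun p : EuclideanSpace ℝ (Fin n) × EuclideanSpace ℝ (Fin n) =>
        ENNReal.ofReal (‖p.1 - p.2‖ ^ 2)) (stdGaussian n) := by
    rw [← map_toLp_pi_gaussianReal]
    refine (transportEntropy_pi_gaussianReal n).map _ (by fun_prop) fun x y => ?_
    rw [EuclideanSpace.real_norm_sq_eq, ENNReal.ofReal_sum_of_nonneg fun i _ => sq_nonneg _]
    rfl
  obtain ⟨γ, hγ1, hγ2, hγc⟩ := hT _ hν (hkl ▸ ENNReal.ofReal_ne_top)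
  refine ⟨γ, ?_, hγ1, hγ2, hγc.trans_eq ?_⟩
  · have : IsProbabilityMeasure (γ.map Prod.fst) := hγ1 ▸ hμ
    exact Measure.isProbabilityMeasure_of_map Prod.fst
  · rw [hkl, ENNReal.ofReal_mul zero_le_two, ENNReal.ofReal_ofNat]
end
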